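/- arXiv:2311.08163 — 9 statements merged into one kernel-verified Lean document; each statement's English description precedes it below -/
import Mathlib

section
/- Let p ∈ [0,1], let n ≥ k be natural numbers, let X be an n-element set and let g be a function from the k-element subsets of X to [0,1]. If w(g, p) = 1 then there exists G ⊆ supp(g) with ⟨g⟩ ⊆ ⟨G⟩ and w(G, p/(4·n^{1/k})) ≤ 1. -/
open Finset

/-- `w(G,p) = ∑_{T ∈ G} p^{|T|}`. -/
noncomputable def wSet {α : Type*} (G : Finset (Finset α)) (p : ℝ) : ℝ :=
  ∑ T ∈ G, p ^ T.card

/-- `w(g,p) = ∑_{T ⊆ X} g(T) p^{|T|}`. -/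
noncomputable def wFun {α : Type*} (X : Finset α) (g : Finset α → ℝ) (p : ℝ) : ℝ :=
  ∑ T ∈ X.powerset, g T * p ^ T.card

/-- If every element of the nonempty family `R` has fractional hitting weight at least one, then
some index of nonzero weight hits at least a fraction `1 / ∑ i ∈ P, g i` of `R`. -/
lemma exists_card_le_card_filter_mul_sum {ι β : Type*} (r : ι → β → Prop)
    [∀ i, DecidablePred (r i)] (P : Finset ι)
    (g : ι → ℝ) (hg : ∀ i ∈ P, 0 ≤ g i) (hM : 0 < ∑ i ∈ P, g i) (R : Finset β)
    (hR : ∀ b ∈ R, 1 ≤ ∑ i ∈ P with r i b, g i) :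
    ∃ i ∈ P, g i ≠ 0 ∧ (#R : ℝ) ≤ #{b ∈ R | r i b} * ∑ i ∈ P, g i := by
  set M := ∑ i ∈ P, g i
  by_contra! hlt
  have hcount : (#R : ℝ) ≤ ∑ i ∈ P, g i * #{b ∈ R | r i b} := by
    calc (#R : ℝ) = ∑ b ∈ R, (1 : ℝ) := by simp
      _ ≤ ∑ b ∈ R, ∑ i ∈ P with r i b, g i := sum_le_sum hR
      _ = ∑ i ∈ P, g i * #{b ∈ R | r i b} := by
        simp_rw [sum_filter]
        rw [sum_comm]
        refine sum_congr rfl fun i _ => ?_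
        rw [← sum_filter, sum_const, nsmul_eq_mul, mul_comm]
  obtain ⟨j, hj, hgj⟩ : ∃ j ∈ P, 0 < g j := by
    by_contra! h
    exact absurd (sum_nonpos h) (not_le.2 hM)
  have hstrict : ∑ i ∈ P, g i * (#{b ∈ R | r i b} * M) < ∑ i ∈ P, g i * #R := by
    refine sum_lt_sum (fun i hi => ?_) ⟨j, hj, mul_lt_mul_of_pos_left (hlt j hj hgj.ne') hgj⟩
    by_cases h : g i = 0
    · simp [h]
    · exact mul_le_mul_of_nonneg_left (hlt i hi h).le (hg i hi)
  simp_rw [← mul_assoc] at hstrict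
  rw [← sum_mul, ← sum_mul, mul_comm] at hstrict
  exact absurd hcount (not_le.2 (lt_of_mul_lt_mul_left hstrict hM.le))

/-- Greedy covering: `m` indices of nonzero weight suffice to leave at most a fraction
`(1 - 1 / ∑ i ∈ P, g i) ^ m` of the family `B` unhit. -/
lemma exists_card_filter_not_hit_le {ι β : Type*} [DecidableEq ι] (r : ι → β → Prop)
    [∀ i, DecidablePred (r i)] (P : Finset ι)
    (g : ι → ℝ) (hg : ∀ i ∈ P, 0 ≤ g i) (hM : 1 ≤ ∑ i ∈ P, g i) (B : Finset β)
    (hB : ∀ b ∈ B, 1 ≤ ∑ i ∈ P with r i b, g i) (m : ℕ) :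
    ∃ G : Finset ι, #G ≤ m ∧ (∀ i ∈ G, g i ≠ 0) ∧
      (#{b ∈ B | ∀ i ∈ G, ¬ r i b} : ℝ) ≤ #B * (1 - (∑ i ∈ P, g i)⁻¹) ^ m := by
  induction m with
  | zero => exact ⟨∅, by simp⟩
  | succ m ih =>
    obtain ⟨G, hcard, hne, hle⟩ := ih
    have hM0 : 0 < ∑ i ∈ P, g i := by linarith
    obtain ⟨j, -, hj, hhit⟩ := exists_card_le_card_filter_mul_sum r P g hg hM0
      {b ∈ B | ∀ i ∈ G, ¬ r i b} fun b hb => hB b (mem_filter.1 hb).1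
    refine ⟨insert j G, (card_insert_le _ _).trans (by lia), ?_, ?_⟩
    · simpa [hj] using hne
    set M := ∑ i ∈ P, g i
    set R := {b ∈ B | ∀ i ∈ G, ¬ r i b}
    have hset : {b ∈ B | ∀ i ∈ insert j G, ¬ r i b} = {b ∈ R | ¬ r j b} := by
      ext b
      simp only [R, mem_filter, forall_mem_insert]
      tauto
    have hsplit : (#{b ∈ R | r j b} : ℝ) + #{b ∈ R | ¬ r j b} = #R := by
      exact_mod_cast card_filter_add_card_filter_not (s := R) (r j)
    have hinv : #R * M⁻¹ ≤ (#{b ∈ R | r j b} : ℝ) := by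
      rwa [← div_eq_mul_inv, div_le_iff₀ hM0]
    have hM1 : 0 ≤ 1 - M⁻¹ := sub_nonneg.2 (inv_le_one_of_one_le₀ hM)
    rw [hset, pow_succ, ← mul_assoc]
    refine le_trans ?_ (mul_le_mul_of_nonneg_right hle hM1)
    linarith

/-- `m ≥ 3 n M` greedy steps reduce `2 ^ n` sets to none. -/
lemma two_pow_mul_one_sub_inv_pow_lt_one {M : ℝ} (hM : 1 ≤ M) {n m : ℕ} (hn : 0 < n)
    (hm : 3 * n * M ≤ m) : (2 : ℝ) ^ n * (1 - M⁻¹) ^ m < 1 := by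
  have hM0 : 0 < M := by linarith
  have hM1 : 0 ≤ 1 - M⁻¹ := sub_nonneg.2 (inv_le_one_of_one_le₀ hM)
  have h2 : (2 : ℝ) ≤ Real.exp 1 := by linarith [Real.add_one_le_exp (1 : ℝ)]
  have hn' : (0 : ℝ) < n := by exact_mod_cast hn
  have hmM : 3 * n ≤ m * M⁻¹ := by rwa [← div_eq_mul_inv, le_div_iff₀ hM0]
  calc (2 : ℝ) ^ n * (1 - M⁻¹) ^ m ≤ Real.exp 1 ^ n * Real.exp (-M⁻¹) ^ m := by
        gcongr
        exact Real.one_sub_le_exp_neg _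
    _ = Real.exp (n - m * M⁻¹) := by
        rw [← Real.exp_nat_mul, ← Real.exp_nat_mul, ← Real.exp_add]
        ring_nf
    _ < 1 := Real.exp_lt_one_iff.2 (by linarith)


/-- Theorem (randomized covering): for `p ∈ [0,1]`, `n ≥ k`, `|X| = n` and
`g : (X choose k) → [0,1]` with `w(g,p) = 1`, there is `G ⊆ supp(g)` with
`⟨g⟩ ⊆ ⟨G⟩` and `w(G, p/(4 n^{1/k})) ≤ 1`. -/
theorem stmt1 {α : Type*} (p : ℝ) (hp0 : 0 ≤ p) (hp1 : p ≤ 1) (n k : ℕ) (hk : 0 < k)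
    (hkn : k ≤ n) (X : Finset α) (hX : X.card = n) (g : Finset α → ℝ)
    (hg : ∀ T, 0 ≤ g T ∧ g T ≤ 1) (hsupp : ∀ T, g T ≠ 0 → T ⊆ X ∧ T.card = k)
    (hw : wFun X g p = 1) :
    ∃ G : Finset (Finset α), (∀ T ∈ G, g T ≠ 0) ∧
      (∀ S ∈ X.powerset, 1 ≤ ∑ T ∈ S.powerset, g T → ∃ T ∈ G, T ⊆ S) ∧
      wSet G (p / (4 * (n : ℝ) ^ ((k : ℝ)⁻¹))) ≤ 1 := by
  classical
  have hn : 0 < n := hk.trans_le hkn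
  have hn1 : (1 : ℝ) ≤ n := by exact_mod_cast hn
  set M := ∑ T ∈ X.powerset, g T with hMdef
  have hMp : M * p ^ k = 1 := by
    rw [← hw, wFun, hMdef, sum_mul]
    refine sum_congr rfl fun T _ => ?_
    by_cases h : g T = 0
    · simp [h]
    · rw [(hsupp T h).2]
  have hM0 : 0 ≤ M := sum_nonneg fun T _ => (hg T).1
  have hM : 1 ≤ M := by
    rw [← hMp]
    exact mul_le_of_le_one_right hM0 (pow_le_one₀ hp0 hp1)
  set B := {S ∈ X.powerset | 1 ≤ ∑ T ∈ S.powerset, g T}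
  have hB : ∀ S ∈ B, 1 ≤ ∑ T ∈ X.powerset with T ⊆ S, g T := by
    intro S hS
    obtain ⟨hSX, hS⟩ := mem_filter.1 hS
    have : {T ∈ X.powerset | T ⊆ S} = S.powerset := by
      ext T
      simp only [mem_filter, mem_powerset, and_iff_right_iff_imp]
      exact fun h => h.trans (mem_powerset.1 hSX)
    rwa [this]
  obtain ⟨G, hcard, hne, hle⟩ := exists_card_filter_not_hit_le (fun T S => T ⊆ S) X.powerset g
    (fun T _ => (hg T).1) hM B hB ⌊(4 : ℝ) ^ k * n * M⌋₊
  have h4 : (4 : ℝ) ≤ 4 ^ k := le_self_pow₀ (by norm_num) hk.ne'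
  have hnM : 1 ≤ n * M := one_le_mul_of_one_le_of_one_le hn1 hM
  have hsteps : 3 * n * M ≤ (⌊(4 : ℝ) ^ k * n * M⌋₊ : ℝ) := by
    have := Nat.lt_floor_add_one ((4 : ℝ) ^ k * n * M)
    nlinarith
  have hBcard : (#B : ℝ) ≤ 2 ^ n := by
    have : #B ≤ 2 ^ n := (card_filter_le _ _).trans (by rw [card_powerset, hX])
    exact_mod_cast this
  have hunhit : (#{S ∈ B | ∀ T ∈ G, ¬ T ⊆ S} : ℝ) < 1 := by
    refine lt_of_le_of_lt (hle.trans ?_) (two_pow_mul_one_sub_inv_pow_lt_one hM hn hsteps)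
    exact mul_le_mul_of_nonneg_right hBcard
      (pow_nonneg (sub_nonneg.2 (inv_le_one_of_one_le₀ hM)) _)
  refine ⟨G, hne, fun S hSX hS => ?_, ?_⟩
  · by_contra! h
    have hmem : S ∈ {S ∈ B | ∀ T ∈ G, ¬ T ⊆ S} := mem_filter.2 ⟨mem_filter.2 ⟨hSX, hS⟩, h⟩
    have hpos : 0 < #{S ∈ B | ∀ T ∈ G, ¬ T ⊆ S} := card_pos.2 ⟨S, hmem⟩
    exact absurd hunhit (not_lt.2 (by exact_mod_cast hpos))
  · have hroot : ((n : ℝ) ^ ((k : ℝ)⁻¹)) ^ k = n :=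
      Real.rpow_inv_natCast_pow (by positivity) hk.ne'
    have hwG : wSet G (p / (4 * (n : ℝ) ^ ((k : ℝ)⁻¹))) = #G * (p ^ k / (4 ^ k * n)) := by
      rw [wSet, sum_congr rfl fun T hT => by rw [(hsupp T (hne T hT)).2], sum_const,
        nsmul_eq_mul, div_pow, mul_pow, hroot]
    have hG : (#G : ℝ) ≤ 4 ^ k * n * M :=
      (Nat.cast_le.2 hcard).trans (Nat.floor_le (by positivity))
    calc wSet G (p / (4 * (n : ℝ) ^ ((k : ℝ)⁻¹))) = #G * (p ^ k / (4 ^ k * n)) := hwG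
      _ ≤ 4 ^ k * n * M * (p ^ k / (4 ^ k * n)) := by gcongr
      _ = M * p ^ k := by field_simp
      _ = 1 := hMp
end

section
/- Let C > 0, let p ∈ [0,1], let n ≥ k be natural numbers with k ≥ C·log₂(n), let X be an n-element set and let g be a function from the k-element subsets of X to [0,1]. If w(g, p) = 1 then there exists G ⊆ supp(g) with ⟨g⟩ ⊆ ⟨G⟩ and w(G, p/(4·2^{1/C})) ≤ 1. -/
open Finset

open scoped Classical in
/-- If each member of `F` has `g`-mass at least `1` below it and `g` has total mass `1 / q`, then
some set in the support of `g` is contained in at least a proportion `q` of the members of `F`. -/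
lemma exists_supp_card_filter_subset {α : Type*} (X : Finset α) (g : Finset α → ℝ) (q : ℝ)
    (hg : ∀ T, 0 ≤ g T) (hw : (∑ T ∈ X.powerset, g T) * q = 1) (F : Finset (Finset α))
    (hFX : ∀ S ∈ F, S ⊆ X) (hF : ∀ S ∈ F, 1 ≤ ∑ T ∈ S.powerset, g T) :
    ∃ T, g T ≠ 0 ∧ q * (F.card : ℝ) ≤ ((F.filter fun S => T ⊆ S).card : ℝ) := by
  have hfilter : ∀ f : Finset α → ℝ,
      ∑ T ∈ X.powerset.filter (fun T => g T ≠ 0), g T * f T = ∑ T ∈ X.powerset, g T * f T := by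
    intro f
    refine sum_filter_of_ne fun T _ h h0 => h ?_
    rw [h0, zero_mul]
  have hne : (X.powerset.filter fun T => g T ≠ 0).Nonempty := by
    by_contra h
    rw [not_nonempty_iff_eq_empty] at h
    have := hfilter fun _ => 1
    rw [h, sum_empty] at this
    simp only [mul_one] at this
    rw [← this] at hw
    simp at hw
  have hdouble : ∑ T ∈ X.powerset, g T * ((F.filter fun S => T ⊆ S).card : ℝ)
      = ∑ S ∈ F, ∑ T ∈ S.powerset, g T := by
    have h1 : ∀ T, g T * ((F.filter fun S => T ⊆ S).card : ℝ)
        = ∑ S ∈ F, if T ⊆ S then g T else 0 := by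
      intro T
      rw [← sum_filter, sum_const, nsmul_eq_mul, mul_comm]
    simp_rw [h1]
    rw [sum_comm]
    refine sum_congr rfl fun S hS => ?_
    rw [← sum_filter]
    refine sum_congr ?_ fun _ _ => rfl
    ext T
    simp only [mem_filter, mem_powerset]
    exact ⟨fun h => h.2, fun h => ⟨h.trans (hFX S hS), h⟩⟩
  have hle : ∑ T ∈ X.powerset.filter (fun T => g T ≠ 0), g T * (q * (F.card : ℝ))
      ≤ ∑ T ∈ X.powerset.filter (fun T => g T ≠ 0),
          g T * ((F.filter fun S => T ⊆ S).card : ℝ) := by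
    rw [hfilter, hfilter, hdouble, ← sum_mul, ← mul_assoc, hw, one_mul]
    simpa using card_nsmul_le_sum F (fun S => ∑ T ∈ S.powerset, g T) 1 hF
  obtain ⟨T, hT, h⟩ := exists_le_of_sum_le hne hle
  have hT0 := (mem_filter.1 hT).2
  exact ⟨T, hT0, le_of_mul_le_mul_left h (lt_of_le_of_ne (hg T) hT0.symm)⟩

open scoped Classical in
/-- Greedy covering: `t` sets from the support of `g` suffice to leave at most a proportion
`(1 - q) ^ t` of the family `F` uncovered. -/
lemma exists_supp_card_uncovered_le {α : Type*} (X : Finset α) (g : Finset α → ℝ) (q : ℝ)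
    (hq : q ≤ 1) (hg : ∀ T, 0 ≤ g T) (hw : (∑ T ∈ X.powerset, g T) * q = 1)
    (F : Finset (Finset α)) (hFX : ∀ S ∈ F, S ⊆ X)
    (hF : ∀ S ∈ F, 1 ≤ ∑ T ∈ S.powerset, g T) (t : ℕ) :
    ∃ G : Finset (Finset α), (∀ T ∈ G, g T ≠ 0) ∧ G.card ≤ t ∧
      ((F.filter fun S => ∀ T ∈ G, ¬ T ⊆ S).card : ℝ) ≤ (1 - q) ^ t * (F.card : ℝ) := by
  induction t with
  | zero => exact ⟨∅, by simp, by simp, by simp⟩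
  | succ t ih =>
    obtain ⟨G, hG0, hGt, hGF⟩ := ih
    obtain ⟨T, hT0, hT⟩ := exists_supp_card_filter_subset X g q hg hw
      (F.filter fun S => ∀ T ∈ G, ¬ T ⊆ S) (fun S hS => hFX S (mem_filter.1 hS).1)
      (fun S hS => hF S (mem_filter.1 hS).1)
    refine ⟨insert T G, ?_, (card_insert_le _ _).trans (by omega), ?_⟩
    · intro T' hT'
      rcases mem_insert.1 hT' with rfl | h
      · exact hT0
      · exact hG0 _ h
    · have heq : (F.filter fun S => ∀ T' ∈ insert T G, ¬ T' ⊆ S)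
          = (F.filter fun S => ∀ T ∈ G, ¬ T ⊆ S).filter fun S => ¬ T ⊆ S := by
        ext S
        simp only [mem_filter, forall_mem_insert]
        tauto
      have hsplit := card_filter_add_card_filter_not
        (s := F.filter fun S => ∀ T ∈ G, ¬ T ⊆ S) (fun S => T ⊆ S)
      rw [heq]
      have hsplit' : (((F.filter fun S => ∀ T ∈ G, ¬ T ⊆ S).filter fun S => T ⊆ S).card : ℝ)
          + (((F.filter fun S => ∀ T ∈ G, ¬ T ⊆ S).filter fun S => ¬ T ⊆ S).card : ℝ)
          = ((F.filter fun S => ∀ T ∈ G, ¬ T ⊆ S).card : ℝ) := by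
        exact_mod_cast hsplit
      calc _ ≤ (1 - q) * ((F.filter fun S => ∀ T ∈ G, ¬ T ⊆ S).card : ℝ) := by linarith
        _ ≤ (1 - q) * ((1 - q) ^ t * (F.card : ℝ)) :=
          mul_le_mul_of_nonneg_left hGF (by linarith)
        _ = _ := by ring

open scoped Classical in
/-- If `g` has total mass `1 / q`, then some subfamily of its support of size at most
`(|X| + 1) / q` contains a subset of every `S ⊆ X` with `g`-mass at least `1` below it. -/
lemma exists_supp_cover_card_mul_le {α : Type*} (X : Finset α) (hX : X.card ≠ 0)
    (g : Finset α → ℝ) (q : ℝ) (hq0 : 0 < q) (hq : q ≤ 1) (hg : ∀ T, 0 ≤ g T)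
    (hw : (∑ T ∈ X.powerset, g T) * q = 1) :
    ∃ G : Finset (Finset α), (∀ T ∈ G, g T ≠ 0) ∧
      (∀ S ∈ X.powerset, 1 ≤ ∑ T ∈ S.powerset, g T → ∃ T ∈ G, T ⊆ S) ∧
      (G.card : ℝ) * q ≤ X.card + 1 := by
  set F := X.powerset.filter fun S => 1 ≤ ∑ T ∈ S.powerset, g T with hFdef
  obtain ⟨G, hG0, hGt, hGF⟩ := exists_supp_card_uncovered_le X g q hq hg hw F
    (fun S hS => mem_powerset.1 (mem_filter.1 hS).1) (fun S hS => (mem_filter.1 hS).2)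
    ⌈(X.card : ℝ) / q⌉₊
  refine ⟨G, hG0, ?_, ?_⟩
  · set t := ⌈(X.card : ℝ) / q⌉₊
    have ht : (X.card : ℝ) ≤ t * q := (div_le_iff₀ hq0).1 (Nat.le_ceil _)
    have hFcard : (F.card : ℝ) ≤ 2 ^ X.card := by
      have := card_filter_le X.powerset fun S => 1 ≤ ∑ T ∈ S.powerset, g T
      rw [card_powerset] at this
      exact_mod_cast this
    have hpow : (1 - q) ^ t ≤ Real.exp (-(X.card : ℝ)) := by
      calc (1 - q) ^ t ≤ Real.exp (-q) ^ t :=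
            pow_le_pow_left₀ (by linarith) (Real.one_sub_le_exp_neg q) t
        _ = Real.exp (t * -q) := (Real.exp_nat_mul _ _).symm
        _ ≤ _ := Real.exp_le_exp.2 (by linarith)
    have hexp : (2 : ℝ) ^ X.card < Real.exp (X.card : ℝ) := by
      rw [← Real.exp_one_pow]
      exact pow_lt_pow_left₀ (by linarith [Real.exp_one_gt_d9]) (by norm_num) hX
    have hlt : ((F.filter fun S => ∀ T ∈ G, ¬ T ⊆ S).card : ℝ) < 1 := by
      calc _ ≤ (1 - q) ^ t * (F.card : ℝ) := hGF
        _ ≤ Real.exp (-(X.card : ℝ)) * 2 ^ X.card := by gcongr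
        _ < Real.exp (-(X.card : ℝ)) * Real.exp (X.card : ℝ) := by gcongr
        _ = 1 := by rw [← Real.exp_add]; simp
    have hempty : (F.filter fun S => ∀ T ∈ G, ¬ T ⊆ S) = ∅ := by
      rw [← card_eq_zero]
      exact Nat.lt_one_iff.1 (by exact_mod_cast hlt)
    intro S hS hS1
    by_contra! h
    have : S ∈ F.filter fun S => ∀ T ∈ G, ¬ T ⊆ S :=
      mem_filter.2 ⟨mem_filter.2 ⟨hS, hS1⟩, h⟩
    rw [hempty] at this
    exact notMem_empty _ this
  · have h1 : (G.card : ℝ) ≤ (X.card : ℝ) / q + 1 :=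
      (Nat.cast_le.2 hGt).trans (Nat.ceil_lt_add_one (by positivity)).le
    calc (G.card : ℝ) * q ≤ ((X.card : ℝ) / q + 1) * q := by gcongr
      _ = X.card + q := by field_simp
      _ ≤ _ := by linarith

/-- Theorem: for `C > 0`, `p ∈ [0,1]`, `n ≥ k ≥ C log₂ n`, `|X| = n` and
`g : (X choose k) → [0,1]` with `w(g,p) = 1`, there is `G ⊆ supp(g)` with
`⟨g⟩ ⊆ ⟨G⟩` and `w(G, p/(4 · 2^{1/C})) ≤ 1`. -/
theorem stmt2 {α : Type*} (C : ℝ) (hC : 0 < C) (p : ℝ) (hp0 : 0 ≤ p) (hp1 : p ≤ 1)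
    (n k : ℕ) (hk : 0 < k) (hkn : k ≤ n) (hCk : C * Real.logb 2 n ≤ (k : ℝ))
    (X : Finset α) (hX : X.card = n) (g : Finset α → ℝ)
    (hg : ∀ T, 0 ≤ g T ∧ g T ≤ 1) (hsupp : ∀ T, g T ≠ 0 → T ⊆ X ∧ T.card = k)
    (hw : wFun X g p = 1) :
    ∃ G : Finset (Finset α), (∀ T ∈ G, g T ≠ 0) ∧
      (∀ S ∈ X.powerset, 1 ≤ ∑ T ∈ S.powerset, g T → ∃ T ∈ G, T ⊆ S) ∧
      wSet G (p / (4 * (2 : ℝ) ^ (1 / C))) ≤ 1 := by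
  have hn : n ≠ 0 := by omega
  have hn1 : (1 : ℝ) ≤ n := by exact_mod_cast Nat.one_le_iff_ne_zero.2 hn
  have hw' : (∑ T ∈ X.powerset, g T) * p ^ k = 1 := by
    rw [← hw, wFun, sum_mul]
    refine sum_congr rfl fun T _ => ?_
    by_cases h : g T = 0
    · simp [h]
    · rw [(hsupp T h).2]
  have hq0 : 0 < p ^ k :=
    lt_of_le_of_ne (pow_nonneg hp0 k) fun h => by rw [← h] at hw'; simp at hw'
  obtain ⟨G, hG0, hGcov, hGcard⟩ := exists_supp_cover_card_mul_le X (hX ▸ hn) g (p ^ k) hq0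
    (pow_le_one₀ hp0 hp1) (fun T => (hg T).1) hw'
  refine ⟨G, hG0, hGcov, ?_⟩
  have hsum : wSet G (p / (4 * (2 : ℝ) ^ (1 / C)))
      = (G.card : ℝ) * (p / (4 * (2 : ℝ) ^ (1 / C))) ^ k := by
    rw [wSet, sum_congr rfl fun T hT => by rw [(hsupp T (hG0 T hT)).2], sum_const, nsmul_eq_mul]
  have hpow : (n : ℝ) ≤ ((2 : ℝ) ^ (1 / C)) ^ k := by
    rw [← Real.rpow_natCast, ← Real.rpow_mul (by norm_num),
      ← Real.logb_le_iff_le_rpow (by norm_num) (by linarith), one_div, inv_mul_eq_div,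
      le_div_iff₀ hC, mul_comm]
    exact hCk
  have h4 : (2 : ℝ) ≤ 4 ^ k :=
    (by norm_num : (2 : ℝ) ≤ 4).trans (le_self_pow₀ (by norm_num) hk.ne')
  rw [hX] at hGcard
  rw [hsum, div_pow, mul_pow, ← mul_div_assoc, div_le_one (by positivity)]
  calc (G.card : ℝ) * p ^ k ≤ n + 1 := hGcard
    _ ≤ 2 * n := by linarith
    _ ≤ 4 ^ k * ((2 : ℝ) ^ (1 / C)) ^ k := by gcongr
end

section
/- Let n ≥ k be natural numbers, let p ∈ [0,1], let X be an n-element set, let V ⊆ X be nonempty and let L > 0. If g is a function from the k-element subsets of X to [0,1] with w(g,p) = 1 such that every S ∈ ⟨g⟩ satisfies |S ∩ V| ≥ (e·p/L)·|V|, then there exists G ⊆ 2^X with ⟨g⟩ ⊆ ⟨G⟩ and w(G, p/L) ≤ 1. -/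
open Finset

/-- The binomial bound `(v choose m) ≤ (e v / m) ^ m`, in a scaled form. -/
theorem choose_mul_pow_le_one (v : ℕ) {m : ℕ} (hm : 0 < m) {q : ℝ} (hq : 0 ≤ q)
    (h : Real.exp 1 * (v * q) ≤ m) : (v.choose m : ℝ) * q ^ m ≤ 1 := by
  have hmm : (0 : ℝ) < (m : ℝ) ^ m := by positivity
  have hf : (0 : ℝ) < m.factorial := by positivity
  have hexp : (m : ℝ) ^ m / m.factorial ≤ Real.exp 1 ^ m := by
    rw [← Real.exp_nat_mul, mul_one]
    exact Real.pow_div_factorial_le_exp _ (Nat.cast_nonneg m) m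
  have hpow : Real.exp 1 ^ m * (v * q) ^ m ≤ (m : ℝ) ^ m := by
    rw [← mul_pow]
    gcongr
  refine le_of_mul_le_mul_left ?_ hmm
  calc (m : ℝ) ^ m * (v.choose m * q ^ m)
      ≤ (m : ℝ) ^ m * ((v : ℝ) ^ m / m.factorial * q ^ m) := by
        gcongr
        exact Nat.choose_le_pow_div m v
    _ = (m : ℝ) ^ m / m.factorial * (v * q) ^ m := by ring
    _ ≤ Real.exp 1 ^ m * (v * q) ^ m := by gcongr
    _ ≤ (m : ℝ) ^ m * 1 := by rwa [mul_one]

/-- The sum of `q ^ |T|` over the `m`-element subsets of a finite set. -/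
theorem sum_powersetCard_pow {α : Type*} (V : Finset α) (m : ℕ) (q : ℝ) :
    ∑ T ∈ V.powersetCard m, q ^ T.card = V.card.choose m * q ^ m := by
  rw [sum_congr rfl fun T hT => by rw [(mem_powersetCard.mp hT).2], sum_const,
    card_powersetCard, nsmul_eq_mul]

/-- Proposition (first part): if `g : (X choose k) → [0,1]` with `w(g,p) = 1` is such that
every `S ∈ ⟨g⟩` satisfies `|S ∩ V| ≥ (e p / L)|V|`, then there is `G ⊆ 2^X` with
`⟨g⟩ ⊆ ⟨G⟩` and `w(G, p/L) ≤ 1`. -/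
theorem stmt4 {α : Type*} [DecidableEq α] (n k : ℕ) (hk : 0 < k) (hkn : k ≤ n)
    (p : ℝ) (hp0 : 0 ≤ p) (hp1 : p ≤ 1) (X : Finset α) (hX : X.card = n)
    (V : Finset α) (hVX : V ⊆ X) (hV : V.Nonempty) (L : ℝ) (hL : 0 < L)
    (g : Finset α → ℝ) (hg : ∀ T, 0 ≤ g T ∧ g T ≤ 1)
    (hsupp : ∀ T, g T ≠ 0 → T ⊆ X ∧ T.card = k)
    (hw : wFun X g p = 1)
    (hint : ∀ S ∈ X.powerset, 1 ≤ ∑ T ∈ S.powerset, g T →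
      Real.exp 1 * p / L * (V.card : ℝ) ≤ ((S ∩ V).card : ℝ)) :
    ∃ G : Finset (Finset α), (∀ T ∈ G, T ⊆ X) ∧
      (∀ S ∈ X.powerset, 1 ≤ ∑ T ∈ S.powerset, g T → ∃ T ∈ G, T ⊆ S) ∧
      wSet G (p / L) ≤ 1 := by
  have hp : 0 < p := by
    refine hp0.lt_of_ne fun h => ?_
    subst h
    refine one_ne_zero (hw.symm.trans (Finset.sum_eq_zero fun T _ => ?_))
    by_cases hT : g T = 0
    · simp [hT]
    · simp [(hsupp T hT).2, hk.ne']
  set x : ℝ := Real.exp 1 * p / L * (V.card : ℝ) with hx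
  have hx0 : 0 < x := by
    have := hV.card_pos
    positivity
  refine ⟨V.powersetCard ⌈x⌉₊, fun T hT => (mem_powersetCard.mp hT).1.trans hVX,
    fun S hS hS1 => ?_, ?_⟩
  · obtain ⟨T, hTS, hT⟩ := exists_subset_card_eq (Nat.ceil_le.mpr (hint S hS hS1))
    exact ⟨T, mem_powersetCard.mpr ⟨hTS.trans inter_subset_right, hT⟩,
      hTS.trans inter_subset_left⟩
  · rw [wSet, sum_powersetCard_pow]
    refine choose_mul_pow_le_one _ (Nat.ceil_pos.mpr hx0) (by positivity) ?_
    calc Real.exp 1 * (V.card * (p / L)) = x := by rw [hx]; ring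
      _ ≤ ⌈x⌉₊ := Nat.le_ceil x
end

section
/- Let n ≥ k be natural numbers, let X be an n-element set, let c > 0 and let g be a function from the k-element subsets of X to [0,1]. Let the random set G ⊆ supp(g) be obtained by including each T ∈ supp(g) into G with probability min{c·g(T), 1}, independently of all other sets. Then P(⟨g⟩ ⊆ ⟨G⟩) ≥ 1 − e^{n−c}. -/
open Finset
open scoped Classical

/-- The support of `g` inside `2^X`, as a finset. -/
noncomputable def suppFun {α : Type*} (X : Finset α) (g : Finset α → ℝ) :
    Finset (Finset α) :=
  X.powerset.filter fun T => g T ≠ 0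

/-- The probability that the random family `G` (each `T ∈ supp(g)` included independently
with probability `min{c·g(T),1}`) equals exactly `H`. -/
noncomputable def probG {α : Type*} (X : Finset α) (g : Finset α → ℝ) (c : ℝ)
    (H : Finset (Finset α)) : ℝ :=
  (∏ T ∈ H, min (c * g T) 1) * ∏ T ∈ suppFun X g \ H, (1 - min (c * g T) 1)

/-- In a random subset of `s` containing each `T` independently with probability `p T`, no element
of `A` is chosen with probability `∏ T ∈ A, (1 - p T)`. -/
theorem sum_powerset_filter_disjoint_prod {β : Type*} [DecidableEq β] (s A : Finset β) (hA : A ⊆ s) (p : β → ℝ) :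
    ∑ H ∈ s.powerset.filter (fun H => Disjoint H A),
      (∏ T ∈ H, p T) * ∏ T ∈ s \ H, (1 - p T) = ∏ T ∈ A, (1 - p T) := by
  have h := Finset.prod_add (fun T => if T ∈ A then 0 else p T) (fun T => 1 - p T) s
  have hl : ∏ T ∈ s, ((if T ∈ A then 0 else p T) + (1 - p T)) = ∏ T ∈ A, (1 - p T) := by
    rw [← Finset.prod_subset hA (f := fun T => (if T ∈ A then 0 else p T) + (1 - p T))]
    · exact Finset.prod_congr rfl fun T hT => by simp [hT]
    · intro T _ hT
      simp [hT]
  rw [← hl, h, Finset.sum_filter]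
  refine Finset.sum_congr rfl fun H _ => ?_
  split_ifs with hd
  · congr 1
    exact Finset.prod_congr rfl fun T hT => by simp [Finset.disjoint_left.mp hd hT]
  · obtain ⟨T, hT, hTA⟩ := Finset.not_disjoint_iff.mp hd
    rw [Finset.prod_eq_zero hT (by simp [hTA]), zero_mul]

/-- The weights of all outcomes sum to one. -/
theorem sum_probG {α : Type*} (X : Finset α) (g : Finset α → ℝ) (c : ℝ) :
    ∑ H ∈ (suppFun X g).powerset, probG X g c H = 1 := by
  rw [← Finset.prod_empty (f := fun T => 1 - min (c * g T) 1),
    ← sum_powerset_filter_disjoint_prod (suppFun X g) ∅ (Finset.empty_subset _)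
      (fun T => min (c * g T) 1),
    Finset.filter_true_of_mem fun H _ => Finset.disjoint_empty_right H]
  rfl

theorem probG_nonneg {α : Type*} (X : Finset α) {g : Finset α → ℝ} {c : ℝ} (hc : 0 ≤ c)
    (hg : ∀ T, 0 ≤ g T) (H : Finset (Finset α)) : 0 ≤ probG X g c H :=
  mul_nonneg
    (Finset.prod_nonneg fun T _ => le_min (mul_nonneg hc (hg T)) zero_le_one)
    (Finset.prod_nonneg fun _ _ => sub_nonneg.mpr (min_le_right _ _))

theorem one_sub_min_one_le_exp_neg (x : ℝ) : 1 - min x 1 ≤ Real.exp (-x) := by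
  rcases le_total x 1 with h | h
  · rw [min_eq_left h]
    linarith [Real.add_one_le_exp (-x)]
  · rw [min_eq_right h, sub_self]
    exact (Real.exp_pos _).le

/-- A fixed member `S` of the cover of `g` is missed by the random family with probability at most
`exp (-c)`. -/
theorem sum_probG_filter_not_covered_le {α : Type*} {X S : Finset α} {g : Finset α → ℝ} {c : ℝ}
    (hc : 0 ≤ c) (hSX : S ⊆ X) (hS : 1 ≤ ∑ T ∈ S.powerset, g T) :
    ∑ H ∈ (suppFun X g).powerset.filter (fun H => ¬ ∃ T ∈ H, T ⊆ S), probG X g c H ≤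
      Real.exp (-c) := by
  set A := S.powerset.filter fun T => g T ≠ 0
  have hAX : A ⊆ suppFun X g :=
    Finset.filter_subset_filter _ (Finset.powerset_mono.mpr hSX)
  have hfilter : (suppFun X g).powerset.filter (fun H => ¬ ∃ T ∈ H, T ⊆ S) =
      (suppFun X g).powerset.filter (fun H => Disjoint H A) := by
    refine Finset.filter_congr fun H hH => ?_
    rw [Finset.disjoint_left]
    constructor
    · intro h T hT hTA
      exact h ⟨T, hT, Finset.mem_powerset.mp (Finset.mem_filter.mp hTA).1⟩
    · rintro h ⟨T, hT, hTS⟩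
      exact h hT (Finset.mem_filter.mpr ⟨Finset.mem_powerset.mpr hTS,
        (Finset.mem_filter.mp (Finset.mem_powerset.mp hH hT)).2⟩)
  have hsum : ∑ T ∈ A, g T = ∑ T ∈ S.powerset, g T := Finset.sum_filter_ne_zero _
  calc _ = ∏ T ∈ A, (1 - min (c * g T) 1) := by
        rw [hfilter]
        exact sum_powerset_filter_disjoint_prod (suppFun X g) A hAX fun T => min (c * g T) 1
    _ ≤ ∏ T ∈ A, Real.exp (-(c * g T)) :=
        Finset.prod_le_prod (fun _ _ => sub_nonneg.mpr (min_le_right _ _))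
          fun _ _ => one_sub_min_one_le_exp_neg _
    _ = Real.exp (-(c * ∑ T ∈ S.powerset, g T)) := by
        rw [← Real.exp_sum, Finset.sum_neg_distrib, ← Finset.mul_sum, hsum]
    _ ≤ Real.exp (-c) :=
        Real.exp_le_exp.mpr (neg_le_neg (le_mul_of_one_le_right hc hS))

/-- Union bound: the total weight of `F` is at most the weight of the `i` satisfying `P` plus the
weights of the events `Q j`, if these cover the complement of `P`. -/
theorem sum_le_sum_filter_add_sum_sum_filter {ι κ : Type*} (F : Finset ι) (B : Finset κ)
    {w : ι → ℝ} (hw : ∀ i, 0 ≤ w i) (P : ι → Prop) {_ : DecidablePred P} (Q : κ → ι → Prop)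
    [∀ j, DecidablePred (Q j)] (h : ∀ i ∈ F, ¬ P i → ∃ j ∈ B, Q j i) :
    ∑ i ∈ F, w i ≤ ∑ i ∈ F.filter P, w i + ∑ j ∈ B, ∑ i ∈ F.filter (Q j), w i := by
  simp only [Finset.sum_filter]
  rw [Finset.sum_comm, ← Finset.sum_add_distrib]
  refine Finset.sum_le_sum fun i hi => ?_
  have hnonneg : ∀ j ∈ B, 0 ≤ if Q j i then w i else 0 := fun j _ => by
    split_ifs
    exacts [hw i, le_rfl]
  by_cases hP : P i
  · rw [if_pos hP]
    exact le_add_of_nonneg_right (Finset.sum_nonneg hnonneg)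
  · obtain ⟨j, hj, hQ⟩ := h i hi hP
    rw [if_neg hP, zero_add]
    simpa [hQ] using Finset.single_le_sum hnonneg hj

/-- Lemma: if `|X| = n ≥ k` and `g : (X choose k) → [0,1]`, and `G ⊆ supp(g)` is random with
each `T ∈ supp(g)` included independently with probability `min{c·g(T),1}`, then
`P(⟨g⟩ ⊆ ⟨G⟩) ≥ 1 - e^{n-c}`.  The probability is written out as the sum, over all
outcomes `H ⊆ supp(g)` satisfying `⟨g⟩ ⊆ ⟨H⟩`, of the product-measure weight of `H`. -/
theorem stmt10 {α : Type*} (n k : ℕ) (hk : 0 < k) (hkn : k ≤ n)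
    (X : Finset α) (hX : X.card = n) (c : ℝ) (hc : 0 < c)
    (g : Finset α → ℝ) (hg : ∀ T, 0 ≤ g T ∧ g T ≤ 1)
    (hsupp : ∀ T, g T ≠ 0 → T ⊆ X ∧ T.card = k) :
    1 - Real.exp ((n : ℝ) - c) ≤
      ∑ H ∈ (suppFun X g).powerset.filter
          (fun H => ∀ S ∈ X.powerset, 1 ≤ ∑ T ∈ S.powerset, g T → ∃ T ∈ H, T ⊆ S),
        probG X g c H := by
  have hg0 : ∀ T, 0 ≤ g T := fun T => (hg T).1
  set B := X.powerset.filter fun S => 1 ≤ ∑ T ∈ S.powerset, g T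
  have hcard : (B.card : ℝ) ≤ Real.exp n :=
    calc (B.card : ℝ) ≤ (2 : ℝ) ^ n := by
          rw [← hX]
          exact_mod_cast (Finset.card_filter_le _ _).trans_eq (Finset.card_powerset X)
      _ ≤ Real.exp 1 ^ n := by
          gcongr
          linarith [Real.add_one_le_exp (1 : ℝ)]
      _ = Real.exp n := by rw [← Real.exp_nat_mul, mul_one]
  have hbad : ∑ S ∈ B, ∑ H ∈ (suppFun X g).powerset.filter (fun H => ¬ ∃ T ∈ H, T ⊆ S),
      probG X g c H ≤ Real.exp ((n : ℝ) - c) :=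
    calc _ ≤ ∑ _S ∈ B, Real.exp (-c) := Finset.sum_le_sum fun S hS =>
          sum_probG_filter_not_covered_le hc.le
            (Finset.mem_powerset.mp (Finset.mem_filter.mp hS).1) (Finset.mem_filter.mp hS).2
      _ = B.card * Real.exp (-c) := by rw [Finset.sum_const, nsmul_eq_mul]
      _ ≤ Real.exp n * Real.exp (-c) := by gcongr
      _ = Real.exp ((n : ℝ) - c) := by rw [← Real.exp_add, sub_eq_add_neg]
  refine sub_le_iff_le_add.mpr ((sum_probG X g c).symm.trans_le ?_)
  refine (sum_le_sum_filter_add_sum_sum_filter _ B (probG_nonneg X hc.le hg0) _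
    (fun S H => ¬ ∃ T ∈ H, T ⊆ S) fun H _ h => ?_).trans (add_le_add_right hbad _)
  simp only [not_forall] at h
  obtain ⟨S, hSX, hS, hH⟩ := h
  exact ⟨S, Finset.mem_filter.mpr ⟨hSX, hS⟩, hH⟩
end

section
/- Let n ≥ k be natural numbers, let X be an n-element set, let c > 0, let p ∈ [0,1] and let g be a function from the k-element subsets of X to [0,1] with w(g, p) = 1. Let the random set G ⊆ supp(g) be obtained by including each T ∈ supp(g) into G with probability min{c·g(T), 1}, independently of all other sets. Then for any L ≥ 1 we have E[w(G, p/L)] ≤ c/L^k. -/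
open Finset
open scoped Classical

/-- For a random subset `H` of `s` containing each `i ∈ s` independently with weight `q i`,
the expectation of `∑ i ∈ H, f i` is `∑ i ∈ s, q i * f i`. -/
theorem sum_powerset_prod_mul_sum {ι R : Type*} [DecidableEq ι] [CommRing R]
    (s : Finset ι) (q f : ι → R) :
    ∑ H ∈ s.powerset, ((∏ i ∈ H, q i) * ∏ i ∈ s \ H, (1 - q i)) * ∑ i ∈ H, f i =
      ∑ i ∈ s, q i * f i := by
  induction s using Finset.induction_on with
  | empty => simp
  | insert a s ha ih =>
    have total : ∑ H ∈ s.powerset, (∏ i ∈ H, q i) * ∏ i ∈ s \ H, (1 - q i) = 1 := by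
      rw [← Finset.prod_add]
      simp
    rw [Finset.sum_powerset_insert ha, Finset.sum_insert ha, ← ih, ← Finset.sum_add_distrib]
    trans ∑ H ∈ s.powerset, (q a * f a * ((∏ i ∈ H, q i) * ∏ i ∈ s \ H, (1 - q i)) +
      ((∏ i ∈ H, q i) * ∏ i ∈ s \ H, (1 - q i)) * ∑ i ∈ H, f i)
    · refine Finset.sum_congr rfl fun H hH => ?_
      have haH : a ∉ H := fun h => ha (Finset.mem_powerset.mp hH h)
      rw [Finset.insert_sdiff_of_notMem s haH, Finset.prod_insert (by simp [ha]),
        Finset.insert_sdiff_insert, Finset.sdiff_insert_of_notMem ha,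
        Finset.prod_insert haH, Finset.sum_insert haH]
      ring
    · rw [Finset.sum_add_distrib, ← Finset.mul_sum, total, mul_one]

/-- Lemma: if `|X| = n ≥ k`, `g : (X choose k) → [0,1]` with `w(g,p) = 1`, and
`G ⊆ supp(g)` is random with each `T ∈ supp(g)` included independently with probability
`min{c·g(T),1}`, then for every `L ≥ 1` we have `E[w(G, p/L)] ≤ c / L^k`.  The
expectation is written out as the sum over all outcomes `H ⊆ supp(g)` of the
product-measure weight of `H` times `w(H, p/L)`. -/
theorem stmt11 {α : Type*} (n k : ℕ) (hk : 0 < k) (hkn : k ≤ n)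
    (X : Finset α) (hX : X.card = n) (c : ℝ) (hc : 0 < c) (p : ℝ)
    (hp0 : 0 ≤ p) (hp1 : p ≤ 1)
    (g : Finset α → ℝ) (hg : ∀ T, 0 ≤ g T ∧ g T ≤ 1)
    (hsupp : ∀ T, g T ≠ 0 → T ⊆ X ∧ T.card = k)
    (hw : wFun X g p = 1) (L : ℝ) (hL : 1 ≤ L) :
    ∑ H ∈ (suppFun X g).powerset, probG X g c H * wSet H (p / L) ≤ c / L ^ k := by
  simp only [probG, wSet]
  rw [sum_powerset_prod_mul_sum]
  have hLpos : 0 < L := by linarith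
  have hw' : ∑ T ∈ suppFun X g, g T * p ^ T.card = 1 := by
    rw [← hw, wFun, suppFun]
    refine Finset.sum_filter_of_ne fun T _ h => left_ne_zero_of_mul h
  calc ∑ T ∈ suppFun X g, min (c * g T) 1 * (p / L) ^ T.card
      ≤ ∑ T ∈ suppFun X g, c / L ^ k * (g T * p ^ T.card) := by
        refine Finset.sum_le_sum fun T hT => ?_
        rw [(hsupp T (Finset.mem_filter.mp hT).2).2]
        calc min (c * g T) 1 * (p / L) ^ k ≤ c * g T * (p / L) ^ k := by
              gcongr
              exact min_le_left _ _
          _ = c / L ^ k * (g T * p ^ k) := by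
              rw [div_pow]
              ring
    _ = c / L ^ k := by rw [← Finset.mul_sum, hw', mul_one]
end

section
/- For every finite set X, every function g from the 1-element subsets of X to [0,1] and every p ∈ [0,1] the following holds: if w(g, p) = 1 then there exists a set G ⊆ 2^X with ⟨g⟩ ⊆ ⟨G⟩ and w(G, p/(4e)) ≤ 1. -/
open Finset

/-- A sum over subsets of a function supported on singletons is a sum over elements. -/
theorem sum_powerset_of_card_one {α : Type*} (S : Finset α) (F : Finset α → ℝ)
    (hF : ∀ T, F T ≠ 0 → T.card = 1) :
    ∑ T ∈ S.powerset, F T = ∑ x ∈ S, F {x} := by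
  have h : ∑ T ∈ S.powersetCard 1, F T = ∑ T ∈ S.powerset, F T := by
    apply Finset.sum_subset
    · intro T hT
      exact mem_powerset.2 (mem_powersetCard.1 hT).1
    · intro T hT hT'
      by_contra h0
      exact hT' (mem_powersetCard.2 ⟨mem_powerset.1 hT, hF T h0⟩)
  rw [← h, powersetCard_one, sum_map]
  rfl

/-- If a set of naturals has fewer than `k` elements below `k * m` for each `k ≥ 1`, then its sum
under an antitone sequence is bounded by an average over an initial segment. -/
theorem mul_sum_le_sum_range_of_sparse (a : ℕ → ℝ) (ha : Antitone a) (m : ℕ) (S : Finset ℕ)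
    (hS : ∀ k, 1 ≤ k → (S.filter (· < k * m)).card < k) :
    (m : ℝ) * ∑ i ∈ S, a i ≤ ∑ i ∈ range (S.card * m), a i := by
  induction S using Finset.induction_on_max with
  | empty => simp
  | insert x s hx ih =>
    have hxs : x ∉ s := fun h => lt_irrefl _ (hx x h)
    have ih' := ih fun k hk =>
      (card_le_card (filter_subset_filter _ (subset_insert x s))).trans_lt (hS k hk)
    have hle : (s.card + 1) * m ≤ x := by
      by_contra! hlt
      have h1 := hS (s.card + 1) (by omega)
      rw [filter_true_of_mem, card_insert_of_notMem hxs] at h1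
      · exact lt_irrefl _ h1
      · intro y hy
        rcases mem_insert.1 hy with rfl | hy
        · exact hlt
        · exact (hx y hy).trans hlt
    rw [sum_insert hxs, card_insert_of_notMem hxs, add_mul, one_mul, sum_range_add, mul_add,
      add_comm]
    refine add_le_add ih' ?_
    have h2 := card_nsmul_le_sum (range m) (fun j => a (s.card * m + j)) (a x) fun j hj =>
      ha (by have := mem_range.1 hj; rw [add_mul, one_mul] at hle; omega)
    simpa using h2

/-- A finite set can be enumerated in order of decreasing weight. -/
theorem exists_antitone_enumeration {α : Type*} (X : Finset α) (h : α → ℝ) :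
    ∃ u : Fin X.card → α, Function.Injective u ∧ (∀ x, x ∈ X ↔ ∃ i, u i = x) ∧
      Antitone (h ∘ u) := by
  let f : Fin X.card → ℝ := fun i => -h (X.equivFin.symm i)
  refine ⟨fun i => X.equivFin.symm (Tuple.sort f i), ?_, ?_, ?_⟩
  · exact Subtype.val_injective.comp (X.equivFin.symm.injective.comp (Tuple.sort f).injective)
  · intro x
    constructor
    · intro hx
      exact ⟨(Tuple.sort f).symm (X.equivFin ⟨x, hx⟩), by simp⟩
    · rintro ⟨i, rfl⟩
      exact Subtype.coe_prop _
  · intro i j hij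
    have := Tuple.monotone_sort f hij
    simpa [f] using this

/-- The weight of the `k`-subsets of a set of size at most `k * m`, at a small parameter. -/
theorem choose_mul_pow_le (N m k : ℕ) (q : ℝ) (hq : 0 ≤ q) (hN : N ≤ k * m)
    (hmq : m * q ≤ 1 / (2 * Real.exp 1)) :
    (N.choose k : ℝ) * q ^ k ≤ (1 / 2) ^ k := by
  have h1 : (N.choose k : ℝ) ≤ (k * m : ℝ) ^ k / k.factorial := by
    refine (Nat.choose_le_pow_div k N).trans ?_
    gcongr
    exact_mod_cast hN
  have h2 : (k : ℝ) ^ k / k.factorial ≤ Real.exp 1 ^ k := by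
    rw [← Real.exp_nat_mul, mul_one]
    exact Real.pow_div_factorial_le_exp _ (Nat.cast_nonneg k) k
  calc (N.choose k : ℝ) * q ^ k ≤ (k * m : ℝ) ^ k / k.factorial * q ^ k := by gcongr
    _ = (k : ℝ) ^ k / k.factorial * (m * q) ^ k := by rw [mul_pow, mul_pow]; ring
    _ ≤ Real.exp 1 ^ k * (1 / (2 * Real.exp 1)) ^ k := by gcongr
    _ = (1 / 2) ^ k := by
      rw [← mul_pow]
      congr 1
      have := Real.exp_pos 1
      field_simp

/-- Sets of large total weight meet some initial segment of an enumeration by decreasing weight in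
many points. -/
theorem exists_card_initial_segment_ge {α : Type*} [DecidableEq α] (X : Finset α) (h : α → ℝ)
    (h0 : ∀ x, 0 ≤ h x) (u : Fin X.card → α) (hu : Function.Injective u)
    (hX : ∀ x, x ∈ X ↔ ∃ i, u i = x) (hanti : Antitone (h ∘ u)) (m : ℕ)
    (hm : ∑ x ∈ X, h x < m) (S : Finset α) (hSX : S ⊆ X) (hS : 1 ≤ ∑ x ∈ S, h x) :
    ∃ k, 1 ≤ k ∧ k ≤ (S ∩ (univ.filter fun i : Fin X.card => i.val < k * m).image u).card := by
  by_contra! hcon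
  let a : ℕ → ℝ := fun j => if hj : j < X.card then h (u ⟨j, hj⟩) else 0
  have ha0 : ∀ j, 0 ≤ a j := by
    intro j
    simp only [a]
    split_ifs
    exacts [h0 _, le_rfl]
  have hav : ∀ i : Fin X.card, a i = h (u i) := by
    intro i
    simp [a]
  have haanti : Antitone a := by
    intro i j hij
    by_cases hj : j < X.card
    · have hi : i < X.card := hij.trans_lt hj
      have := @hanti ⟨i, hi⟩ ⟨j, hj⟩ hij
      simpa [a, hi, hj] using this
    · have : a j = 0 := by simp [a, hj]
      rw [this]
      exact ha0 i
  have himg : ∀ T ⊆ X, (univ.filter fun i => u i ∈ T).image u = T := by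
    intro T hT
    ext x
    simp only [mem_image, mem_filter, mem_univ, true_and]
    constructor
    · rintro ⟨i, hi, rfl⟩
      exact hi
    · intro hx
      obtain ⟨i, rfl⟩ := (hX x).1 (hT hx)
      exact ⟨i, hx, rfl⟩
  have hsum : ∀ T ⊆ X, ∑ j ∈ (univ.filter fun i => u i ∈ T).map Fin.valEmbedding, a j =
      ∑ x ∈ T, h x := by
    intro T hT
    rw [sum_map]
    conv_rhs => rw [← himg T hT]
    rw [sum_image hu.injOn]
    exact sum_congr rfl fun i _ => hav i
  have hsparse := mul_sum_le_sum_range_of_sparse a haanti m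
    ((univ.filter fun i => u i ∈ S).map Fin.valEmbedding) (by
      intro k hk
      refine lt_of_le_of_lt ?_ (hcon k hk)
      rw [filter_map, card_map, ← card_image_of_injective _ hu]
      apply card_le_card
      intro x hx
      simp only [mem_image, mem_filter, mem_univ, true_and, mem_inter] at hx ⊢
      obtain ⟨i, ⟨hi, hi'⟩, rfl⟩ := hx
      exact ⟨hi, i, hi', rfl⟩)
  rw [hsum S hSX] at hsparse
  have htotal : ∀ r, ∑ j ∈ range r, a j ≤ ∑ x ∈ X, h x := by
    intro r
    rw [← hsum X subset_rfl]
    rw [← sum_filter_ne_zero]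
    refine sum_le_sum_of_subset_of_nonneg (fun j hj => ?_) fun j _ _ => ha0 j
    have hjX : j < X.card := by
      by_contra hlt
      exact (mem_filter.1 hj).2 (by simp [a, hlt])
    simp only [mem_map, mem_filter, mem_univ, true_and]
    exact ⟨⟨j, hjX⟩, (hX _).2 ⟨_, rfl⟩, rfl⟩
  have hmm : (m : ℝ) ≤ m * ∑ x ∈ S, h x := le_mul_of_one_le_right (Nat.cast_nonneg m) hS
  linarith [htotal (((univ.filter fun i => u i ∈ S).map Fin.valEmbedding).card * m)]

/-- Proposition (singletons): for any finite `X`, `g : (X choose 1) → [0,1]` and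
`p ∈ [0,1]`, if `w(g,p) = 1` then there is `G ⊆ 2^X` with `⟨g⟩ ⊆ ⟨G⟩` and
`w(G, p/(4e)) ≤ 1`. -/
theorem stmt12 {α : Type*} (X : Finset α) (g : Finset α → ℝ) (p : ℝ)
    (hp0 : 0 ≤ p) (hp1 : p ≤ 1)
    (hg : ∀ T, 0 ≤ g T ∧ g T ≤ 1)
    (hsupp : ∀ T, g T ≠ 0 → T ⊆ X ∧ T.card = 1)
    (hw : wFun X g p = 1) :
    ∃ G : Finset (Finset α), (∀ T ∈ G, T ⊆ X) ∧
      (∀ S ∈ X.powerset, 1 ≤ ∑ T ∈ S.powerset, g T → ∃ T ∈ G, T ⊆ S) ∧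
      wSet G (p / (4 * Real.exp 1)) ≤ 1 := by
  classical
  have hpow := sum_powerset_of_card_one X (fun T => g T * p ^ T.card)
    fun T hT => (hsupp T (left_ne_zero_of_mul hT)).2
  have hsum : (∑ x ∈ X, g {x}) * p = 1 := by
    rw [← hw, wFun, hpow, sum_mul]
    simp
  have hp : 0 < p := by
    refine lt_of_le_of_ne hp0 ?_
    rintro rfl
    simp at hsum
  obtain ⟨u, hu, hX, hanti⟩ := exists_antitone_enumeration X fun x => g {x}
  set m := ⌊2 / p⌋₊ with hm
  have hm_le : (m : ℝ) ≤ 2 / p := Nat.floor_le (by positivity)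
  have hm_gt : ∑ x ∈ X, g {x} < m := by
    have h1 : 2 / p < m + 1 := Nat.lt_floor_add_one _
    have h2 : ∑ x ∈ X, g {x} = 1 / p := by
      rw [eq_div_iff hp.ne', hsum]
    have h3 : 1 ≤ 1 / p := (one_le_div hp).2 hp1
    have h4 : 2 / p = 1 / p + 1 / p := by ring
    linarith
  have hmq : (m : ℝ) * (p / (4 * Real.exp 1)) ≤ 1 / (2 * Real.exp 1) := by
    have he := Real.exp_pos 1
    calc (m : ℝ) * (p / (4 * Real.exp 1)) ≤ 2 / p * (p / (4 * Real.exp 1)) := by gcongr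
      _ = 1 / (2 * Real.exp 1) := by field_simp; norm_num
  have hq : 0 ≤ p / (4 * Real.exp 1) := by positivity
  let I : ℕ → Finset α := fun k => (univ.filter fun i : Fin X.card => i.val < k * m).image u
  have hIX : ∀ k, I k ⊆ X := by
    intro k x hx
    obtain ⟨i, -, rfl⟩ := mem_image.1 hx
    exact (hX _).2 ⟨i, rfl⟩
  have hIcard : ∀ k, (I k).card ≤ k * m := by
    intro k
    refine card_image_le.trans ?_
    rw [← card_map Fin.valEmbedding]
    refine (card_le_card (t := range (k * m)) ?_).trans (card_range _).le
    intro j hj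
    simp only [mem_map, mem_filter, mem_univ, true_and] at hj
    obtain ⟨i, hi, rfl⟩ := hj
    exact mem_range.2 hi
  refine ⟨(Ico 1 (X.card + 1)).biUnion fun k => powersetCard k (I k), ?_, ?_, ?_⟩
  · intro T hT
    obtain ⟨k, -, hk⟩ := mem_biUnion.1 hT
    exact (mem_powersetCard.1 hk).1.trans (hIX k)
  · intro S hS hgS
    rw [sum_powerset_of_card_one S g fun T hT => (hsupp T hT).2] at hgS
    obtain ⟨k, hk1, hk⟩ := exists_card_initial_segment_ge X (fun x => g {x})
      (fun x => (hg _).1) u hu hX hanti m hm_gt S (mem_powerset.1 hS) hgS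
    obtain ⟨T, hT, hTk⟩ := exists_subset_card_eq hk
    have hTS : T ⊆ S := hT.trans inter_subset_left
    have hkX : k ≤ X.card := hTk ▸ card_le_card (hTS.trans (mem_powerset.1 hS))
    exact ⟨T, mem_biUnion.2 ⟨k, mem_Ico.2 ⟨hk1, by omega⟩,
      mem_powersetCard.2 ⟨hT.trans inter_subset_right, hTk⟩⟩, hTS⟩
  · rw [wSet, sum_biUnion fun i _ j _ hij => disjoint_left.2 fun T hi hj =>
      hij ((mem_powersetCard.1 hi).2.symm.trans (mem_powersetCard.1 hj).2)]
    calc ∑ k ∈ Ico 1 (X.card + 1), ∑ T ∈ powersetCard k (I k), (p / (4 * Real.exp 1)) ^ T.card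
        ≤ ∑ k ∈ Ico 1 (X.card + 1), (1 / 2 : ℝ) ^ k := by
          refine sum_le_sum fun k _ => ?_
          rw [sum_congr rfl fun T hT => by rw [(mem_powersetCard.1 hT).2], sum_const,
            card_powersetCard, nsmul_eq_mul]
          exact choose_mul_pow_le _ m k _ hq (hIcard k) hmq
      _ ≤ 1 := by
          have h1 := sum_range_succ' (fun k => (1 / 2 : ℝ) ^ k) X.card
          have h2 := sum_geometric_two_le (X.card + 1)
          rw [sum_Ico_eq_sum_range]
          simp only [add_tsub_cancel_right, add_comm 1]
          simp only [pow_zero] at h1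
          linarith
end

section
/- For all n, k ∈ ℕ with n ≥ k, J ≥ 1, r > 0, L ≥ 2^{10}·e², any n-element set X and any function g from the k-element subsets of X to [0,∞) which equals 1/r on its support and whose support has maximum codegree Δ₂(supp(g)) ≤ 1 (i.e. supp(g) is a linear k-uniform hypergraph), the following holds. If w(g, p) = 1 then there exists a set G ⊆ 2^X with ⟨g⟩_{J,L} ⊆ ⟨G⟩ and w(G, p/L) ≤ (1/L)^{√(J·r)/2^7}. -/
open Finset
open scoped Classical

/-- `∑_{x ∈ S} ∑_{T : x ∈ T} g(T)`, where `T` ranges over `k`-subsets of `X`. -/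
noncomputable def degSum {α : Type*} [DecidableEq α] (X : Finset α) (k : ℕ)
    (g : Finset α → ℝ) (S : Finset α) : ℝ :=
  ∑ x ∈ S, ∑ T ∈ (X.powersetCard k).filter fun T => x ∈ T, g T

/-- `⟨g⟩_{J,L}`: the sets `S` with
`∑_{T ∈ binom(S,k)} g(T) ≥ max{J, (L/(4ek)) (∑_{T} g(T))^{-1+1/k} ∑_{x∈S} ∑_{T∋x} g(T)}`. -/
noncomputable def coverJL {α : Type*} [DecidableEq α] (X : Finset α) (k : ℕ)
    (g : Finset α → ℝ) (J L : ℝ) : Set (Finset α) :=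
  {S | max J (L / (4 * Real.exp 1 * k) *
        (∑ T ∈ X.powersetCard k, g T) ^ (-1 + (k : ℝ)⁻¹) * degSum X k g S) ≤
      ∑ T ∈ S.powersetCard k, g T}

/-- A sum of nonnegative terms over an image is at most the sum over the source. -/
theorem sum_image_le_sum {ι β : Type*} [DecidableEq β] (s : Finset ι) (φ : ι → β) (f : β → ℝ)
    (hf : ∀ b, 0 ≤ f b) : ∑ b ∈ s.image φ, f b ≤ ∑ i ∈ s, f (φ i) := by
  induction s using Finset.induction_on with
  | empty => simp
  | insert a s ha ih =>
    rw [image_insert, sum_insert ha]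
    by_cases h : φ a ∈ s.image φ
    · rw [insert_eq_of_mem h]
      linarith [hf (φ a)]
    · rw [sum_insert h]
      linarith

/-- A sum of nonnegative terms over a union is at most the sum of the sums over the parts. -/
theorem sum_biUnion_le_sum {ι β : Type*} [DecidableEq β] (s : Finset ι) (u : ι → Finset β)
    (f : β → ℝ) (hf : ∀ b, 0 ≤ f b) :
    ∑ b ∈ s.biUnion u, f b ≤ ∑ i ∈ s, ∑ b ∈ u i, f b := by
  induction s using Finset.induction_on with
  | empty => simp
  | insert a s ha ih =>
    rw [biUnion_insert, sum_insert ha]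
    have h := sum_union_inter (s₁ := u a) (s₂ := s.biUnion u) (f := f)
    have h' : 0 ≤ ∑ b ∈ u a ∩ s.biUnion u, f b := sum_nonneg fun b _ => hf b
    linarith

/-- The elementary symmetric sum of order `s` is at most `(eZ/s)^s` when the terms sum to at most
`Z`. -/
theorem sum_powersetCard_prod_le {ι : Type*} (A : Finset ι) (f : ι → ℝ) (hf : ∀ a, 0 ≤ f a)
    (s : ℕ) (hs : 1 ≤ s) (Z : ℝ) (hZ : 0 < Z) (hfZ : ∑ a ∈ A, f a ≤ Z) :
    ∑ P ∈ A.powersetCard s, ∏ a ∈ P, f a ≤ (Real.exp 1 * Z / s) ^ s := by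
  have hs0 : (0 : ℝ) < s := by exact_mod_cast hs
  set y : ℝ := s / Z with hy
  have hy0 : 0 < y := by positivity
  have h1 : y ^ s * ∑ P ∈ A.powersetCard s, ∏ a ∈ P, f a ≤ Real.exp s := by
    calc y ^ s * ∑ P ∈ A.powersetCard s, ∏ a ∈ P, f a
        = ∑ P ∈ A.powersetCard s, ∏ a ∈ P, (y * f a) := by
          rw [mul_sum]
          refine sum_congr rfl fun P hP => ?_
          rw [prod_mul_distrib, prod_const, (mem_powersetCard.1 hP).2]
      _ ≤ ∑ P ∈ A.powerset, ∏ a ∈ P, (y * f a) := by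
          refine sum_le_sum_of_subset_of_nonneg ?_ fun P _ _ =>
            prod_nonneg fun a _ => mul_nonneg hy0.le (hf a)
          intro P hP
          exact mem_powerset.2 (mem_powersetCard.1 hP).1
      _ = ∏ a ∈ A, (1 + y * f a) := (prod_one_add A).symm
      _ ≤ Real.exp (∑ a ∈ A, y * f a) :=
          Real.prod_one_add_le_exp_sum _ fun a => mul_nonneg hy0.le (hf a)
      _ ≤ Real.exp s := by
          rw [← mul_sum]
          refine Real.exp_le_exp.2 ?_
          calc y * ∑ a ∈ A, f a ≤ y * Z := by gcongr
            _ = s := by rw [hy]; field_simp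
  have h2 : Real.exp 1 * Z / s = Real.exp 1 / y := by
    rw [hy]; field_simp
  rw [h2, div_pow, le_div_iff₀ (by positivity), ← Real.exp_nat_mul, mul_one, mul_comm]
  exact h1

theorem choose_le_exp_mul_div_pow (d t : ℕ) (ht : 1 ≤ t) :
    (d.choose t : ℝ) ≤ (Real.exp 1 * d / t) ^ t := by
  have ht0 : (0 : ℝ) < t := by exact_mod_cast ht
  have h1 := Nat.choose_le_pow_div (α := ℝ) t d
  have h2 : (t : ℝ) ^ t / t.factorial ≤ Real.exp 1 ^ t := by
    rw [← Real.exp_nat_mul, mul_one]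
    exact Real.pow_div_factorial_le_exp _ ht0.le t
  have hf : (0 : ℝ) < t.factorial := by exact_mod_cast t.factorial_pos
  refine h1.trans ?_
  rw [div_pow, mul_pow, div_le_div_iff₀ hf (by positivity)]
  rw [div_le_iff₀ hf] at h2
  calc (d : ℝ) ^ t * (t : ℝ) ^ t ≤ (d : ℝ) ^ t * (Real.exp 1 ^ t * t.factorial) := by gcongr
    _ = _ := by ring

theorem sum_two_pow_ite_le (a : ℝ) (ha : 0 ≤ a) (N : ℕ) :
    ∑ i ∈ range N, (if (2 : ℝ) ^ i < a then (2 : ℝ) ^ i else 0) ≤ 2 * a := by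
  induction N with
  | zero => simpa using ha
  | succ N ih =>
    by_cases h : (2 : ℝ) ^ N < a
    · calc ∑ i ∈ range (N + 1), (if (2 : ℝ) ^ i < a then (2 : ℝ) ^ i else 0)
          ≤ ∑ i ∈ range (N + 1), (2 : ℝ) ^ i := by
            refine sum_le_sum fun i _ => ?_
            split_ifs
            · exact le_rfl
            · positivity
        _ = 2 ^ (N + 1) - 1 := by rw [geom_sum_eq (by norm_num)]; norm_num
        _ ≤ 2 * a := by rw [pow_succ]; linarith
    · rw [sum_range_succ, if_neg h, add_zero]
      exact ih

theorem sum_inv_two_pow_lt (N : ℕ) : ∑ i ∈ range N, ((2 : ℝ) ^ i)⁻¹ < 2 := by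
  have h : ∑ i ∈ range N, ((2 : ℝ) ^ i)⁻¹ = 2 - 2 * (1 / 2) ^ N := by
    induction N with
    | zero => simp
    | succ N ih =>
      rw [sum_range_succ, ih, pow_succ, ← inv_pow]
      norm_num
      ring
  rw [h]
  have : (0 : ℝ) < (1 / 2) ^ N := by positivity
  linarith

/-- Dyadic pigeonhole: some scale `2 ^ i` carries a number `s` of stars large enough for the
weight estimate. -/
theorem exists_scale (M : ℝ) (hM : 0 < M) (k : ℕ) (hk : 0 < k) (N : ℕ) (ν : ℕ → ℕ)
    (h : M ≤ ∑ i ∈ range N, 4 * (k : ℝ) * ν i * 4 ^ i) :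
    ∃ i < N, ∃ s, 1 ≤ s ∧ s ≤ ν i ∧ √M ≤ 4 * k * s * 2 ^ i ∧
      M ≤ 16 * k * s * (2 ^ i) ^ 3 := by
  by_contra! hcon
  have hk1 : (1 : ℝ) ≤ k := by exact_mod_cast hk
  have hs0 : 0 < √M := Real.sqrt_pos.2 hM
  have hsq : √M * √M = M := Real.mul_self_sqrt hM.le
  have key : ∀ i ∈ range N, 4 * (k : ℝ) * ν i * 4 ^ i ≤
      √M * (if (2 : ℝ) ^ i < √M / 4 then (2 : ℝ) ^ i else 0) + M / 4 * ((2 : ℝ) ^ i)⁻¹ := by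
    intro i hi
    have hi := mem_range.1 hi
    set t : ℝ := 2 ^ i with ht
    have ht1 : 1 ≤ t := one_le_pow₀ (by norm_num)
    have h4 : (4 : ℝ) ^ i = t * t := by
      rw [ht, ← mul_pow]; norm_num
    rw [h4]
    have hR : 0 ≤ M / 4 * t⁻¹ := by positivity
    rcases Nat.eq_zero_or_pos (ν i) with h0 | h0
    · rw [h0]
      have : 0 ≤ √M * (if t < √M / 4 then t else 0) := by
        refine mul_nonneg hs0.le ?_
        split_ifs <;> linarith
      simpa using add_nonneg this hR
    have hlt : t < √M / 4 := by
      by_contra! hge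
      have h1 := hcon i hi 1 le_rfl h0 (by
        push_cast
        nlinarith)
      push_cast at h1
      have h2 : M ≤ 16 * (t * t) := by nlinarith
      have h3 : t * t ≤ t ^ 3 := by
        rw [← sq]
        exact pow_le_pow_right₀ ht1 (by norm_num)
      have h4 : t ^ 3 ≤ k * t ^ 3 := le_mul_of_one_le_left (by positivity) hk1
      linarith
    rw [if_pos hlt]
    by_cases hc : √M ≤ 4 * k * ν i * t
    · have h1 := hcon i hi (ν i) h0 le_rfl hc
      have h2 : 4 * (k : ℝ) * ν i * (t * t) ≤ M / 4 * t⁻¹ := by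
        rw [← div_eq_mul_inv, le_div_iff₀ (by linarith)]
        nlinarith
      nlinarith [mul_pos hs0 (by linarith : 0 < t)]
    · push Not at hc
      nlinarith
  have h1 := h.trans (sum_le_sum key)
  rw [sum_add_distrib, ← mul_sum, ← mul_sum] at h1
  have h2 := sum_two_pow_ite_le (√M / 4) (by positivity) N
  have h3 := sum_inv_two_pow_lt N
  have h4 := mul_le_mul_of_nonneg_left h2 hs0.le
  have h5 := mul_lt_mul_of_pos_left h3 (by positivity : 0 < M / 4)
  nlinarith

/-- Charging argument: the edges of `E` are bounded by the vertices of the sets `U i`, provided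
that few edges at a vertex `x` with `ρ x ≤ 2 ^ i` avoid `U i`. -/
theorem card_le_charge {α : Type*} [DecidableEq α] (S : Finset α) (E : Finset (Finset α))
    (hES : ∀ e ∈ E, e ⊆ S) (hne : ∀ e ∈ E, e.Nonempty) (ρ : α → ℝ) (hρ : ∀ x, 0 ≤ ρ x)
    (U : ℕ → Finset α) (N : ℕ) (hU : ∀ i, N ≤ i → U i = ∅)
    (hfew : ∀ i, ∀ x ∈ S, ρ x ≤ 2 ^ i → #{e ∈ E | x ∈ e ∧ Disjoint e (U i)} < 2 ^ i) :
    (#E : ℝ) ≤ ∑ x ∈ S, 2 * ρ x + ∑ i ∈ range N, (#(U i) : ℝ) * 2 ^ (i + 1) := by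
  have hex : ∀ x, ∃ j : ℕ, ρ x ≤ 2 ^ j := fun x =>
    (pow_unbounded_of_one_lt (ρ x) (by norm_num : (1 : ℝ) < 2)).imp fun _ h => h.le
  let j : α → ℕ := fun x => Nat.find (hex x)
  have hj : ∀ x, ρ x ≤ 2 ^ j x := fun x => Nat.find_spec (hex x)
  let A : α → Finset (Finset α) := fun x =>
    if j x = 0 then ∅ else {e ∈ E | x ∈ e ∧ Disjoint e (U (j x))}
  let B : ℕ → α → Finset (Finset α) := fun i x =>
    if ρ x ≤ 2 ^ (i + 1) then {e ∈ E | x ∈ e ∧ Disjoint e (U (i + 1))} else ∅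
  have hA : ∀ x ∈ S, (#(A x) : ℝ) ≤ 2 * ρ x := by
    intro x hx
    by_cases h0 : j x = 0
    · simpa [A, h0] using hρ x
    · obtain ⟨l, hl⟩ := Nat.exists_eq_succ_of_ne_zero h0
      have h1 : ¬ ρ x ≤ 2 ^ l := Nat.find_min (hex x) (by change l < j x; omega)
      have h2 := hfew (j x) x hx (hj x)
      have h3 : (#(A x) : ℝ) < 2 ^ (j x) := by
        simp only [A, if_neg h0]
        exact_mod_cast h2
      rw [hl, Nat.succ_eq_add_one, pow_succ] at h3
      push Not at h1
      linarith
  have hB : ∀ i, ∀ x ∈ S, (#(B i x) : ℝ) ≤ 2 ^ (i + 1) := by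
    intro i x hx
    by_cases h0 : ρ x ≤ 2 ^ (i + 1)
    · simp only [B, if_pos h0]
      exact_mod_cast (hfew (i + 1) x hx h0).le
    · simp [B, h0]
  have hcov : E ⊆ S.biUnion A ∪ (range N).biUnion fun i => (U i ∩ S).biUnion (B i) := by
    intro e he
    by_contra hnot
    simp only [mem_union, mem_biUnion, not_or, not_exists, not_and, mem_range, mem_inter] at hnot
    obtain ⟨hnA, hnB⟩ := hnot
    have hall : ∀ l ≤ N, Disjoint e (U (N - l)) ∧ ∀ i ≥ N - l, Disjoint e (U i) := by
      intro l
      induction l with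
      | zero =>
        intro _
        refine ⟨by simp [hU N le_rfl], fun i hi => ?_⟩
        rw [hU i (by simpa using hi)]
        simp
      | succ l ih =>
        intro hl
        obtain ⟨-, ih2⟩ := ih (by omega)
        have hd : Disjoint e (U (N - (l + 1))) := by
          by_contra hnd
          obtain ⟨x, hxe, hxU⟩ := not_disjoint_iff.1 hnd
          have hxS := hES e he hxe
          by_cases hr : ρ x ≤ 2 ^ (N - (l + 1) + 1)
          · refine hnB (N - (l + 1)) (by omega) x ⟨hxU, hxS⟩ ?_
            simp only [B, if_pos hr, mem_filter]
            exact ⟨he, hxe, ih2 _ (by omega)⟩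
          · refine hnA x hxS ?_
            have hjl : N - (l + 1) + 1 < j x := by
              by_contra! hle
              exact hr ((hj x).trans (pow_le_pow_right₀ (by norm_num) hle))
            simp only [A, if_neg (by omega : ¬ j x = 0), mem_filter]
            exact ⟨he, hxe, ih2 _ (by omega)⟩
        refine ⟨hd, fun i hi => ?_⟩
        rcases Nat.lt_or_ge i (N - l) with h | h
        · rwa [show i = N - (l + 1) by omega]
        · exact ih2 i h
    obtain ⟨x, hx⟩ := hne e he
    have hxS := hES e he hx
    have hd := (hall N le_rfl).2
    simp only [Nat.sub_self, ge_iff_le, zero_le, forall_const] at hd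
    by_cases h0 : j x = 0
    · have h1 := hfew 0 x hxS (by simpa [h0] using hj x)
      rw [pow_zero, Nat.lt_one_iff, card_eq_zero] at h1
      exact notMem_empty e (h1 ▸ mem_filter.2 ⟨he, hx, hd 0⟩)
    · refine hnA x hxS ?_
      simp only [A, if_neg h0, mem_filter]
      exact ⟨he, hx, hd _⟩
  have h1 : (#E : ℝ) ≤ #(S.biUnion A) +
      #((range N).biUnion fun i => (U i ∩ S).biUnion (B i)) := by
    exact_mod_cast (card_le_card hcov).trans (card_union_le _ _)
  have h2 : (#(S.biUnion A) : ℝ) ≤ ∑ x ∈ S, 2 * ρ x := by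
    calc (#(S.biUnion A) : ℝ) ≤ ∑ x ∈ S, (#(A x) : ℝ) := by exact_mod_cast card_biUnion_le
      _ ≤ _ := sum_le_sum hA
  have h3 : (#((range N).biUnion fun i => (U i ∩ S).biUnion (B i)) : ℝ) ≤
      ∑ i ∈ range N, (#(U i) : ℝ) * 2 ^ (i + 1) := by
    calc (#((range N).biUnion fun i => (U i ∩ S).biUnion (B i)) : ℝ)
        ≤ ∑ i ∈ range N, (#((U i ∩ S).biUnion (B i)) : ℝ) := by exact_mod_cast card_biUnion_le
      _ ≤ _ := by
        refine sum_le_sum fun i _ => ?_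
        calc (#((U i ∩ S).biUnion (B i)) : ℝ) ≤ ∑ x ∈ U i ∩ S, (#(B i x) : ℝ) := by
              exact_mod_cast card_biUnion_le
          _ ≤ ∑ x ∈ U i ∩ S, (2 : ℝ) ^ (i + 1) :=
              sum_le_sum fun x hx => hB i x (mem_inter.1 hx).2
          _ = (#(U i ∩ S) : ℝ) * 2 ^ (i + 1) := by rw [sum_const, nsmul_eq_mul]
          _ ≤ _ := by
              gcongr
              exact inter_subset_left
  linarith

/-- The vertex sets of stars with `t` edges of `H` whose centre lies in `C`. -/
noncomputable def starSets {α : Type*} [DecidableEq α] (H : Finset (Finset α)) (C : Finset α)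
    (t : ℕ) : Finset (Finset α) :=
  C.biUnion fun x => ({e ∈ H | x ∈ e}.powersetCard t).image fun F => F.biUnion id

theorem mem_starSets {α : Type*} [DecidableEq α] {H : Finset (Finset α)} {C : Finset α} {t : ℕ}
    {A : Finset α} : A ∈ starSets H C t ↔
      ∃ x ∈ C, ∃ F : Finset (Finset α), F ⊆ {e ∈ H | x ∈ e} ∧ #F = t ∧ F.biUnion id = A := by
  simp [starSets, mem_powersetCard, and_assoc]

theorem starSets_mono {α : Type*} [DecidableEq α] {H H' : Finset (Finset α)} {C C' : Finset α}
    (hH : H ⊆ H') (hC : C ⊆ C') (t : ℕ) : starSets H C t ⊆ starSets H' C' t := by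
  intro A hA
  obtain ⟨x, hx, F, hF, hFt, rfl⟩ := mem_starSets.1 hA
  exact mem_starSets.2 ⟨x, hC hx, F, hF.trans (filter_subset_filter _ hH), hFt, rfl⟩

theorem subset_of_mem_starSets {α : Type*} [DecidableEq α] {H : Finset (Finset α)}
    {C X A : Finset α} {t : ℕ} (hHX : ∀ e ∈ H, e ⊆ X) (hA : A ∈ starSets H C t) : A ⊆ X := by
  obtain ⟨x, hx, F, hF, hFt, rfl⟩ := mem_starSets.1 hA
  exact biUnion_subset.2 fun e he => hHX e (mem_filter.1 (hF he)).1

theorem card_le_of_mem_starSets {α : Type*} [DecidableEq α] {H : Finset (Finset α)}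
    {C A : Finset α} {k t : ℕ} (hk : ∀ e ∈ H, #e = k) (hA : A ∈ starSets H C t) :
    #A ≤ t * k := by
  obtain ⟨x, hx, F, hF, rfl, rfl⟩ := mem_starSets.1 hA
  exact card_biUnion_le_card_mul _ _ _ fun e he => (hk e (mem_filter.1 (hF he)).1).le

theorem le_card_star {α : Type*} [DecidableEq α] {H F : Finset (Finset α)} {k t : ℕ}
    (hk : ∀ e ∈ H, #e = k) (hlin : ∀ e ∈ H, ∀ f ∈ H, e ≠ f → #(e ∩ f) ≤ 1) (x : α)
    (hF : F ⊆ {e ∈ H | x ∈ e}) (ht : 1 ≤ t) (hFt : #F = t) :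
    1 + (k - 1) * t ≤ #(F.biUnion id) := by
  have hdisj : (F : Set (Finset α)).PairwiseDisjoint fun e => e.erase x := by
    intro e he f hf hef
    obtain ⟨heH, hxe⟩ := mem_filter.1 (hF he)
    obtain ⟨hfH, hxf⟩ := mem_filter.1 (hF hf)
    refine disjoint_left.2 fun y hye hyf => ?_
    have h1 := card_le_one.1 (hlin e heH f hfH hef) x (mem_inter.2 ⟨hxe, hxf⟩) y
      (mem_inter.2 ⟨mem_of_mem_erase hye, mem_of_mem_erase hyf⟩)
    exact ne_of_mem_erase hye h1.symm
  have hcard : #(F.biUnion fun e => e.erase x) = (k - 1) * t := by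
    rw [card_biUnion hdisj, sum_congr rfl (g := fun _ => k - 1), sum_const, hFt, smul_eq_mul,
      mul_comm]
    intro e he
    obtain ⟨heH, hxe⟩ := mem_filter.1 (hF he)
    rw [card_erase_of_mem hxe, hk e heH]
  have hnot : x ∉ F.biUnion fun e => e.erase x := by simp
  rw [← hcard, add_comm, ← card_insert_of_notMem hnot]
  refine card_le_card (insert_subset ?_ ?_)
  · obtain ⟨e, he⟩ := card_pos.1 (by omega : 0 < #F)
    exact mem_biUnion.2 ⟨e, he, (mem_filter.1 (hF he)).2⟩
  · exact biUnion_mono fun e _ => erase_subset _ _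

theorem sum_starSets_le {α : Type*} [DecidableEq α] {H : Finset (Finset α)} {k t : ℕ}
    (hk : ∀ e ∈ H, #e = k) (hlin : ∀ e ∈ H, ∀ f ∈ H, e ≠ f → #(e ∩ f) ≤ 1) (C : Finset α)
    (ht : 1 ≤ t) (q : ℝ) (hq0 : 0 ≤ q) (hq1 : q ≤ 1) :
    ∑ A ∈ starSets H C t, q ^ #A ≤
      ∑ x ∈ C, ((#{e ∈ H | x ∈ e}).choose t : ℝ) * q ^ (1 + (k - 1) * t) := by
  refine (sum_biUnion_le_sum _ _ _ fun A => pow_nonneg hq0 _).trans (sum_le_sum fun x _ => ?_)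
  refine (sum_image_le_sum _ _ _ fun A => pow_nonneg hq0 _).trans ?_
  rw [← card_powersetCard, ← nsmul_eq_mul, ← sum_const]
  refine sum_le_sum fun F hF => ?_
  obtain ⟨hF, hFt⟩ := mem_powersetCard.1 hF
  exact pow_le_pow_of_le_one hq0 hq1 (le_card_star hk hlin x hF ht hFt)

/-- The sets that are unions of `s` pairwise disjoint members of `𝒜`. -/
noncomputable def packingUnions {α : Type*} [DecidableEq α] (𝒜 : Finset (Finset α)) (s : ℕ) :
    Finset (Finset α) :=
  ((𝒜.powersetCard s).filter fun P : Finset (Finset α) =>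
    (P : Set (Finset α)).PairwiseDisjoint id).image fun P => P.biUnion id

theorem wSet_packingUnions_le {α : Type*} [DecidableEq α] (𝒜 : Finset (Finset α)) (s : ℕ)
    (hs : 1 ≤ s) (q : ℝ) (hq0 : 0 ≤ q) (Z : ℝ) (hZ : 0 < Z) (hle : ∑ A ∈ 𝒜, q ^ #A ≤ Z) :
    wSet (packingUnions 𝒜 s) q ≤ (Real.exp 1 * Z / s) ^ s := by
  refine le_trans ?_ (sum_powersetCard_prod_le 𝒜 (fun A => q ^ #A) (fun A => pow_nonneg hq0 _)
    s hs Z hZ hle)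
  refine (sum_image_le_sum _ _ _ fun A => pow_nonneg hq0 _).trans ?_
  refine le_trans (le_of_eq (sum_congr rfl fun P hP => ?_)) (sum_le_sum_of_subset_of_nonneg
    (filter_subset (fun P : Finset (Finset α) => (P : Set (Finset α)).PairwiseDisjoint id) _)
    fun P _ _ => prod_nonneg fun A _ => pow_nonneg hq0 _)
  rw [prod_pow_eq_pow_sum, card_biUnion (mem_filter.1 hP).2]
  rfl

/-- A hypergraph on `S` whose edges outnumber the weights `ρ` contains a large packing of stars
of some dyadic size `2 ^ i` with centres of weight at most `2 ^ i`. -/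
theorem exists_star_packing {α : Type*} [DecidableEq α] (S : Finset α) (E : Finset (Finset α))
    (k : ℕ) (hk : 0 < k) (hES : ∀ e ∈ E, e ⊆ S) (hEk : ∀ e ∈ E, #e = k) (ρ : α → ℝ)
    (hρ : ∀ x, 0 ≤ ρ x) (hρE : ∑ x ∈ S, 2 * ρ x ≤ #E / 2) (M : ℝ) (hM : 0 < M) (hME : M ≤ #E)
    (N : ℕ) (hN : #E ≤ N) :
    ∃ i < N, ∃ P ⊆ starSets E {x ∈ S | ρ x ≤ 2 ^ i} (2 ^ i),
      (P : Set (Finset α)).PairwiseDisjoint id ∧ 1 ≤ #P ∧ √M ≤ 4 * k * #P * 2 ^ i ∧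
      M ≤ 16 * k * #P * (2 ^ i) ^ 3 := by
  have hmax : ∀ i : ℕ, ∃ Q ⊆ starSets E {x ∈ S | ρ x ≤ 2 ^ i} (2 ^ i),
      (Q : Set (Finset α)).PairwiseDisjoint id ∧
      ∀ Q' ⊆ starSets E {x ∈ S | ρ x ≤ 2 ^ i} (2 ^ i),
        (Q' : Set (Finset α)).PairwiseDisjoint id → #Q' ≤ #Q := by
    intro i
    obtain ⟨Q, hQ, hQmax⟩ := exists_max_image
      ((starSets E {x ∈ S | ρ x ≤ 2 ^ i} (2 ^ i)).powerset.filter fun Q : Finset (Finset α) =>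
        (Q : Set (Finset α)).PairwiseDisjoint id) card
      ⟨∅, by simp⟩
    obtain ⟨hQ1, hQ2⟩ := mem_filter.1 hQ
    exact ⟨Q, mem_powerset.1 hQ1, hQ2, fun Q' h1 h2 =>
      hQmax Q' (mem_filter.2 ⟨mem_powerset.2 h1, h2⟩)⟩
  choose Q hQsub hQdisj hQmax using hmax
  have hcharge := card_le_charge S E hES
    (fun e he => card_pos.1 (by rw [hEk e he]; exact hk)) ρ hρ (fun i => (Q i).biUnion id) N
    (by
      intro i hi
      suffices h : Q i = ∅ by simp [h]
      refine eq_empty_of_forall_notMem fun A hA => ?_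
      obtain ⟨x, hx, F, hF, hFt, -⟩ := mem_starSets.1 (hQsub i hA)
      have h1 := card_le_card (hF.trans (filter_subset _ _))
      have h2 := Nat.lt_two_pow_self (n := i)
      omega)
    (by
      intro i x hxS hx
      by_contra! hge
      obtain ⟨F, hF, hFt⟩ := exists_subset_card_eq hge
      have hmem : F.biUnion id ∈ starSets E {x ∈ S | ρ x ≤ 2 ^ i} (2 ^ i) := by
        refine mem_starSets.2 ⟨x, mem_filter.2 ⟨hxS, hx⟩, F, fun e he => ?_, hFt, rfl⟩
        obtain ⟨heE, hxe, -⟩ := mem_filter.1 (hF he)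
        exact mem_filter.2 ⟨heE, hxe⟩
      have hdis : Disjoint (F.biUnion id) ((Q i).biUnion id) :=
        (disjoint_biUnion_left _ _ _).2 fun e he => (mem_filter.1 (hF he)).2.2
      have hxF : x ∈ F.biUnion id := by
        obtain ⟨e, he⟩ := card_pos.1 (by rw [hFt]; positivity : 0 < #F)
        exact mem_biUnion.2 ⟨e, he, (mem_filter.1 (hF he)).2.1⟩
      have hnot : F.biUnion id ∉ Q i := fun h =>
        disjoint_left.1 hdis hxF (mem_biUnion.2 ⟨_, h, hxF⟩)
      have h1 := hQmax i (insert (F.biUnion id) (Q i)) (insert_subset hmem (hQsub i)) (by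
        rw [coe_insert]
        refine (hQdisj i).insert fun A hA _ => ?_
        exact (disjoint_biUnion_right _ _ _).1 hdis A hA)
      rw [card_insert_of_notMem hnot] at h1
      omega)
  have hsum : M ≤ ∑ i ∈ range N, 4 * (k : ℝ) * (#(Q i) : ℕ) * 4 ^ i := by
    have h1 : ∑ i ∈ range N, (#((Q i).biUnion id) : ℝ) * 2 ^ (i + 1) ≤
        ∑ i ∈ range N, 2 * (k : ℝ) * (#(Q i) : ℕ) * 4 ^ i := by
      refine sum_le_sum fun i _ => ?_
      have h2 : #((Q i).biUnion id) ≤ #(Q i) * (2 ^ i * k) :=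
        card_biUnion_le_card_mul _ _ _ fun A hA => card_le_of_mem_starSets hEk (hQsub i hA)
      have h3 : (#((Q i).biUnion id) : ℝ) ≤ #(Q i) * (2 ^ i * k) := by exact_mod_cast h2
      have h4 : (4 : ℝ) ^ i = 2 ^ i * 2 ^ i := by rw [← mul_pow]; norm_num
      calc (#((Q i).biUnion id) : ℝ) * 2 ^ (i + 1)
          ≤ #(Q i) * (2 ^ i * k) * 2 ^ (i + 1) := by gcongr
        _ = _ := by rw [h4]; ring
    have h5 : ∑ i ∈ range N, 4 * (k : ℝ) * (#(Q i) : ℕ) * 4 ^ i =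
        2 * ∑ i ∈ range N, 2 * (k : ℝ) * (#(Q i) : ℕ) * 4 ^ i := by
      rw [mul_sum]
      exact sum_congr rfl fun i _ => by ring
    linarith
  obtain ⟨i, hi, s, hs1, hs2, hs3, hs4⟩ := exists_scale M hM k hk N (fun i => #(Q i)) hsum
  obtain ⟨P, hPQ, rfl⟩ := exists_subset_card_eq hs2
  exact ⟨i, hi, P, hPQ.trans (hQsub i), (hQdisj i).subset (by exact_mod_cast hPQ), hs1, hs3, hs4⟩

theorem mul_sq_mul_pow_le (a : ℝ) (ha : 1 ≤ a) (k t : ℕ) (hk : 1 ≤ k) :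
    (k : ℝ) * t ^ 2 * (a * k) ^ t ≤ (4 * a) ^ (k * t) := by
  rcases Nat.eq_zero_or_pos t with rfl | ht
  · simp
  obtain ⟨j, rfl⟩ := Nat.exists_eq_add_of_le' hk
  have h1 : ((j + 1 : ℕ) : ℝ) ≤ 2 ^ j := by exact_mod_cast Nat.lt_two_pow_self (n := j)
  have h2 : (t : ℝ) ≤ 2 ^ t := by exact_mod_cast Nat.lt_two_pow_self.le
  have h3 : a ^ t ≤ a ^ ((j + 1) * t) :=
    pow_le_pow_right₀ ha (Nat.le_mul_of_pos_left t (Nat.succ_pos j))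
  have h4 : ((j + 1 : ℕ) : ℝ) ≤ (2 ^ j) ^ t :=
    h1.trans (le_self_pow₀ (one_le_pow₀ (by norm_num)) ht.ne')
  calc ((j + 1 : ℕ) : ℝ) * t ^ 2 * (a * (j + 1 : ℕ)) ^ t
      ≤ (2 ^ j) ^ t * (2 ^ t) ^ 2 * (a * 2 ^ j) ^ t := by gcongr
    _ = 4 ^ ((j + 1) * t) * a ^ t := by
      rw [mul_pow, show (4 : ℝ) = 2 ^ 2 by norm_num]
      simp only [← pow_mul]
      ring
    _ ≤ 4 ^ ((j + 1) * t) * a ^ ((j + 1) * t) := by gcongr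
    _ = _ := (mul_pow _ _ _).symm

theorem packing_weight_le (k t s : ℕ) (hk : 1 ≤ k) (ht : 1 ≤ t) (hs : 1 ≤ s) (L r M : ℝ)
    (hL : 2 ^ 10 * Real.exp 1 ^ 2 ≤ L) (hr : 0 < r) (hrs : r ≤ 16 * k * s * t ^ 3)
    (hM : √M ≤ 4 * k * s * t) :
    (Real.exp 1 * (Real.exp 1 / t * (16 * Real.exp 1 ^ 2 * k / L) ^ (t - 1) *
      (1 / L) ^ (1 + (k - 1) * t) * (k * r)) / s) ^ s ≤
      (1 / 8) ^ (t * s) * (1 / L) ^ (√M / 2 ^ 7) := by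
  set a : ℝ := Real.exp 1 ^ 2 with ha
  have ha1 : 1 ≤ a := one_le_pow₀ (Real.one_le_exp (by norm_num))
  have ha8 : a ≤ 2 ^ 4 := by
    have := Real.exp_one_lt_d9
    have h0 := Real.exp_pos 1
    rw [ha]
    nlinarith
  have hL0 : 0 < L := by linarith
  have hL1 : 1 ≤ L := by linarith
  have hk0 : (0 : ℝ) < k := by exact_mod_cast hk
  have ht0 : (0 : ℝ) < t := by exact_mod_cast ht
  have hs0 : (0 : ℝ) < s := by exact_mod_cast hs
  have hbase : Real.exp 1 * (Real.exp 1 / t * (16 * a * k / L) ^ (t - 1) *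
      (1 / L) ^ (1 + (k - 1) * t) * (k * r)) / s ≤ (64 * a / L) ^ (k * t) := by
    have hexp : (t - 1) + (1 + (k - 1) * t) = k * t := by
      obtain ⟨j, rfl⟩ := Nat.exists_eq_add_of_le' hk
      obtain ⟨u, rfl⟩ := Nat.exists_eq_add_of_le' ht
      simp only [Nat.add_sub_cancel]
      ring
    calc Real.exp 1 * (Real.exp 1 / t * (16 * a * k / L) ^ (t - 1) *
          (1 / L) ^ (1 + (k - 1) * t) * (k * r)) / s
        = a * k * (16 * a * k / L) ^ (t - 1) * (1 / L) ^ (1 + (k - 1) * t) / (s * t) * r := by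
          rw [ha]; field_simp
      _ ≤ a * k * (16 * a * k / L) ^ (t - 1) * (1 / L) ^ (1 + (k - 1) * t) / (s * t) *
          (16 * k * s * t ^ 3) := by gcongr
      _ = k * t ^ 2 * ((16 * a * k) * (16 * a * k) ^ (t - 1)) *
          ((1 / L) ^ (t - 1) * (1 / L) ^ (1 + (k - 1) * t)) := by
          rw [div_eq_mul_one_div (16 * a * k) L, mul_pow]
          field_simp
      _ = k * t ^ 2 * (16 * a * k) ^ t * (1 / L) ^ (k * t) := by
          rw [← pow_succ', Nat.sub_add_cancel ht, ← pow_add, hexp]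
      _ ≤ (4 * (16 * a)) ^ (k * t) * (1 / L) ^ (k * t) := by
          gcongr
          exact mul_sq_mul_pow_le (16 * a) (by linarith) k t hk
      _ = (64 * a / L) ^ (k * t) := by rw [← mul_pow]; congr 1; ring
  have hroot : 64 * a / L ≤ 1 / 8 * (1 / L) ^ ((1 : ℝ) / 32) := by
    have h1 : (1 / L) ^ ((31 : ℝ) / 32) ≤ 1 / (512 * a) := by
      have h2 : (1 / L) ^ ((31 : ℝ) / 32) ≤ (1 / (2 ^ 10 * a)) ^ ((31 : ℝ) / 32) := by
        refine Real.rpow_le_rpow (by positivity) ?_ (by norm_num)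
        exact one_div_le_one_div_of_le (by positivity) hL
      have h3 : (2 ^ 10 * a) ^ ((1 : ℝ) / 32) ≤ 2 := by
        calc (2 ^ 10 * a) ^ ((1 : ℝ) / 32) ≤ ((2 : ℝ) ^ (32 : ℝ)) ^ ((1 : ℝ) / 32) := by
              refine Real.rpow_le_rpow (by positivity) ?_ (by norm_num)
              norm_num
              linarith
          _ = 2 := by rw [← Real.rpow_mul (by norm_num)]; norm_num
      have h4 : (1 / (2 ^ 10 * a)) ^ ((31 : ℝ) / 32) =
          1 / (2 ^ 10 * a) * (2 ^ 10 * a) ^ ((1 : ℝ) / 32) := by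
        rw [one_div, Real.inv_rpow (by positivity), ← Real.rpow_neg_one (2 ^ 10 * a),
          ← Real.rpow_neg (by positivity), ← Real.rpow_add (by positivity)]
        norm_num
      rw [h4] at h2
      refine h2.trans ?_
      calc 1 / (2 ^ 10 * a) * (2 ^ 10 * a) ^ ((1 : ℝ) / 32) ≤ 1 / (2 ^ 10 * a) * 2 := by gcongr
        _ = 1 / (512 * a) := by field_simp; norm_num
    have h5 : 1 / L = (1 / L) ^ ((31 : ℝ) / 32) * (1 / L) ^ ((1 : ℝ) / 32) := by
      rw [← Real.rpow_add (by positivity)]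
      norm_num
    calc 64 * a / L = 64 * a * (1 / L) := by ring
      _ = 64 * a * ((1 / L) ^ ((31 : ℝ) / 32) * (1 / L) ^ ((1 : ℝ) / 32)) := by rw [← h5]
      _ ≤ 64 * a * (1 / (512 * a) * (1 / L) ^ ((1 : ℝ) / 32)) := by gcongr
      _ = _ := by field_simp; norm_num
  calc _ ≤ ((64 * a / L) ^ (k * t)) ^ s := by gcongr
    _ ≤ ((1 / 8 * (1 / L) ^ ((1 : ℝ) / 32)) ^ (k * t)) ^ s := by gcongr
    _ = (1 / 8) ^ (k * t * s) * (1 / L) ^ ((1 : ℝ) / 32 * (k * t * s : ℕ)) := by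
        rw [← pow_mul, mul_pow, Real.rpow_mul (by positivity), Real.rpow_natCast]
    _ ≤ (1 / 8) ^ (t * s) * (1 / L) ^ (√M / 2 ^ 7) := by
        gcongr ?_ * ?_
        · refine pow_le_pow_of_le_one (by norm_num) (by norm_num) ?_
          exact Nat.mul_le_mul_right s (Nat.le_mul_of_pos_left t hk)
        · refine Real.rpow_le_rpow_of_exponent_ge (by positivity) ?_ ?_
          · rw [div_le_one hL0]; exact hL1
          · push_cast
            linarith

theorem sum_card_incident {α : Type*} [DecidableEq α] (X : Finset α) (H : Finset (Finset α))
    (k : ℕ) (hHX : ∀ e ∈ H, e ⊆ X) (hHk : ∀ e ∈ H, #e = k) :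
    ∑ x ∈ X, #{e ∈ H | x ∈ e} = k * #H := by
  simp only [card_filter]
  rw [sum_comm, sum_congr rfl (g := fun _ => k), sum_const, smul_eq_mul, mul_comm]
  intro e he
  rw [← card_filter, filter_mem_eq_inter, inter_eq_right.2 (hHX e he), hHk e he]

theorem sum_starSets_le_of_rich {α : Type*} [DecidableEq α] (X : Finset α)
    (H : Finset (Finset α)) (k t : ℕ) (hk : 1 ≤ k) (ht : 1 ≤ t) (hHX : ∀ e ∈ H, e ⊆ X)
    (hHk : ∀ e ∈ H, #e = k) (hlin : ∀ e ∈ H, ∀ f ∈ H, e ≠ f → #(e ∩ f) ≤ 1) (p L : ℝ)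
    (hp0 : 0 ≤ p) (hp1 : p ≤ 1) (hL : 1 ≤ L) (C : Finset α) (hCX : C ⊆ X)
    (hC : ∀ x ∈ C, L / (16 * Real.exp 1 * k) * (p ^ (k - 1) * #{e ∈ H | x ∈ e}) ≤ t) :
    ∑ A ∈ starSets H C t, (p / L) ^ #A ≤
      Real.exp 1 / t * (16 * Real.exp 1 ^ 2 * k / L) ^ (t - 1) * (1 / L) ^ (1 + (k - 1) * t) *
        (k * (#H * p ^ k)) := by
  have hL0 : 0 < L := by linarith
  have ht0 : (0 : ℝ) < t := by exact_mod_cast ht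
  have hk0 : (0 : ℝ) < k := by exact_mod_cast hk
  have he := Real.exp_pos 1
  set c : ℝ := Real.exp 1 / t * (16 * Real.exp 1 ^ 2 * k / L) ^ (t - 1) *
    (1 / L) ^ (1 + (k - 1) * t) with hc
  have hc0 : 0 ≤ c := by positivity
  refine (sum_starSets_le hHk hlin C ht (p / L) (by positivity)
    ((div_le_one hL0).2 (hp1.trans hL))).trans ?_
  have hterm : ∀ x ∈ C, ((#{e ∈ H | x ∈ e}).choose t : ℝ) * (p / L) ^ (1 + (k - 1) * t) ≤
      c * (p ^ k * #{e ∈ H | x ∈ e}) := by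
    intro x hx
    have hr := hC x hx
    set d := #{e ∈ H | x ∈ e} with hd
    set y : ℝ := Real.exp 1 * (p ^ (k - 1) * d) / t with hy
    have hy0 : 0 ≤ y := by positivity
    have hyb : y ≤ 16 * Real.exp 1 ^ 2 * k / L := by
      rw [hy, div_le_div_iff₀ ht0 hL0]
      rw [div_mul_eq_mul_div, div_le_iff₀ (by positivity)] at hr
      nlinarith
    calc (d.choose t : ℝ) * (p / L) ^ (1 + (k - 1) * t)
        ≤ (Real.exp 1 * d / t) ^ t * (p / L) ^ (1 + (k - 1) * t) := by
          gcongr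
          exact choose_le_exp_mul_div_pow d t ht
      _ = y ^ t * p * (1 / L) ^ (1 + (k - 1) * t) := by
          have h1 : y ^ t = (Real.exp 1 * d / t) ^ t * p ^ ((k - 1) * t) := by
            rw [pow_mul, ← mul_pow, hy]
            congr 1
            ring
          rw [h1, div_eq_mul_one_div p L, mul_pow p, pow_add p]
          ring
      _ = y * y ^ (t - 1) * p * (1 / L) ^ (1 + (k - 1) * t) := by
          rw [← pow_succ', Nat.sub_add_cancel ht]
      _ ≤ y * (16 * Real.exp 1 ^ 2 * k / L) ^ (t - 1) * p * (1 / L) ^ (1 + (k - 1) * t) := by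
          gcongr
      _ = c * (p ^ (k - 1) * p * d) := by rw [hy, hc]; ring
      _ = c * (p ^ k * d) := by rw [← pow_succ, Nat.sub_add_cancel hk]
  refine (sum_le_sum hterm).trans ?_
  rw [← mul_sum, ← mul_sum]
  refine mul_le_mul_of_nonneg_left ?_ hc0
  have h1 : ∑ x ∈ C, (#{e ∈ H | x ∈ e} : ℝ) ≤ k * #H := by
    exact_mod_cast (sum_le_sum_of_subset hCX).trans (sum_card_incident X H k hHX hHk).le
  calc p ^ k * ∑ x ∈ C, (#{e ∈ H | x ∈ e} : ℝ) ≤ p ^ k * (k * #H) := by gcongr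
    _ = _ := by ring

theorem eighth_pow_le (i s : ℕ) :
    (1 / 8 : ℝ) ^ (2 ^ i * (s + 1)) ≤ (1 / 2) * (2 ^ i)⁻¹ * ((1 / 2) * (2 ^ s)⁻¹) := by
  have h1 : i + 1 ≤ 2 ^ i := Nat.lt_two_pow_self
  have h2 : (i + 1) + (s + 1) ≤ 3 * (2 ^ i * (s + 1)) := by nlinarith
  calc (1 / 8 : ℝ) ^ (2 ^ i * (s + 1)) = (1 / 2) ^ (3 * (2 ^ i * (s + 1))) := by
        rw [pow_mul (1 / 2 : ℝ) 3]; norm_num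
    _ ≤ (1 / 2) ^ ((i + 1) + (s + 1)) := pow_le_pow_of_le_one (by norm_num) (by norm_num) h2
    _ = _ := by rw [pow_add, pow_succ, pow_succ, ← inv_pow, ← inv_pow]; norm_num; ring

/-- The covering theorem for a linear `k`-uniform hypergraph `H`, in terms of edge counts. -/
theorem exists_cover_of_linear {α : Type*} [DecidableEq α] (X : Finset α)
    (H : Finset (Finset α)) (k : ℕ) (hk : 1 ≤ k) (hHX : ∀ e ∈ H, e ⊆ X) (hHk : ∀ e ∈ H, #e = k)
    (hlin : ∀ e ∈ H, ∀ f ∈ H, e ≠ f → #(e ∩ f) ≤ 1) (p L M : ℝ) (hp0 : 0 ≤ p) (hp1 : p ≤ 1)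
    (hL : 2 ^ 10 * Real.exp 1 ^ 2 ≤ L) (hH : 0 < #H * p ^ k) (hM : #H * p ^ k ≤ M) :
    ∃ G : Finset (Finset α), (∀ T ∈ G, T ⊆ X) ∧
      (∀ S ⊆ X, M ≤ #{e ∈ H | e ⊆ S} →
        L * p ^ (k - 1) * ∑ x ∈ S, (#{e ∈ H | x ∈ e} : ℝ) ≤
          4 * Real.exp 1 * k * #{e ∈ H | e ⊆ S} → ∃ T ∈ G, T ⊆ S) ∧
      wSet G (p / L) ≤ (1 / L) ^ (√M / 2 ^ 7) := by
  have he := Real.exp_pos 1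
  have hL1 : 1 ≤ L := by nlinarith [Real.one_le_exp (zero_le_one' ℝ)]
  have hL0 : 0 < L := by linarith
  have hk0 : (0 : ℝ) < k := by exact_mod_cast hk
  set ρ : α → ℝ := fun x => L / (16 * Real.exp 1 * k) * (p ^ (k - 1) * #{e ∈ H | x ∈ e}) with hρ
  have hρ0 : ∀ x, 0 ≤ ρ x := fun x => by positivity
  set 𝒜 : ℕ → Finset (Finset α) := fun i => starSets H {x ∈ X | ρ x ≤ 2 ^ i} (2 ^ i)
  let I : ℕ → Finset ℕ := fun i => (range #(𝒜 i)).filter fun s =>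
    √M ≤ 4 * k * (s + 1 : ℕ) * 2 ^ i ∧ M ≤ 16 * k * (s + 1 : ℕ) * (2 ^ i) ^ 3
  refine ⟨(range #H).biUnion fun i => (I i).biUnion fun s => packingUnions (𝒜 i) (s + 1),
    ?_, ?_, ?_⟩
  · intro T hT
    obtain ⟨i, -, hT⟩ := mem_biUnion.1 hT
    obtain ⟨s, -, hT⟩ := mem_biUnion.1 hT
    obtain ⟨P, hP, rfl⟩ := mem_image.1 hT
    refine biUnion_subset.2 fun A hA => ?_
    exact subset_of_mem_starSets hHX ((mem_powersetCard.1 (mem_filter.1 hP).1).1 hA)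
  · intro S hSX hMS hS
    obtain ⟨i, hi, P, hP, hPd, hP1, hP2, hP3⟩ := exists_star_packing S {e ∈ H | e ⊆ S} k hk
      (fun e he => (mem_filter.1 he).2) (fun e he => hHk e (mem_filter.1 he).1) ρ hρ0 (by
        have h1 : ∑ x ∈ S, 2 * ρ x = L * p ^ (k - 1) * (∑ x ∈ S, (#{e ∈ H | x ∈ e} : ℝ)) /
            (8 * Real.exp 1 * k) := by
          rw [mul_sum, sum_div]
          refine sum_congr rfl fun x _ => ?_
          rw [hρ]
          field_simp
          ring
        rw [h1, div_le_iff₀ (by positivity)]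
        linarith) M (hH.trans_le hM) hMS #H (card_filter_le _ _)
    have hPA : P ⊆ 𝒜 i := hP.trans
      (starSets_mono (filter_subset _ _) (filter_subset_filter _ hSX) _)
    obtain ⟨s, hs⟩ := Nat.exists_eq_add_of_le' hP1
    refine ⟨P.biUnion id, mem_biUnion.2 ⟨i, mem_range.2 hi, mem_biUnion.2 ⟨s, ?_, ?_⟩⟩, ?_⟩
    · refine mem_filter.2 ⟨mem_range.2 ?_, ?_, ?_⟩
      · have := card_le_card hPA
        omega
      · rw [← hs]; exact hP2
      · rw [← hs]; exact hP3
    · exact mem_image.2 ⟨P, mem_filter.2 ⟨mem_powersetCard.2 ⟨hPA, hs⟩, hPd⟩, rfl⟩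
    · exact biUnion_subset.2 fun A hA =>
        subset_of_mem_starSets (fun e he => (mem_filter.1 he).2) (hP hA)
  · set W : ℝ := (1 / L) ^ (√M / 2 ^ 7)
    have hW0 : 0 ≤ W := by positivity
    have hq0 : 0 ≤ p / L := by positivity
    have hpow : ∀ T : Finset α, 0 ≤ (p / L) ^ #T := fun T => pow_nonneg hq0 _
    have hpack : ∀ i, ∀ s ∈ I i, wSet (packingUnions (𝒜 i) (s + 1)) (p / L) ≤
        (1 / 2) * (2 ^ i)⁻¹ * ((1 / 2) * (2 ^ s)⁻¹) * W := by
      intro i s hs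
      obtain ⟨-, hs1, hs2⟩ := mem_filter.1 hs
      have ht : 1 ≤ 2 ^ i := Nat.one_le_two_pow
      have h1 := sum_starSets_le_of_rich X H k (2 ^ i) hk ht hHX hHk hlin p L hp0 hp1 hL1
        {x ∈ X | ρ x ≤ 2 ^ i} (filter_subset _ _) (by
          intro x hx
          push_cast
          exact (mem_filter.1 hx).2)
      have h2 := wSet_packingUnions_le (𝒜 i) (s + 1) (Nat.le_add_left 1 s) (p / L) hq0 _
        (by positivity) h1
      have h3 := packing_weight_le k (2 ^ i) (s + 1) hk ht (Nat.le_add_left 1 s) L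
        (#H * p ^ k) M hL hH (by push_cast at hs2 ⊢; exact hM.trans hs2)
        (by push_cast at hs1 ⊢; exact hs1)
      exact (h2.trans h3).trans (mul_le_mul_of_nonneg_right (eighth_pow_le i s) hW0)
    calc wSet _ (p / L)
        ≤ ∑ i ∈ range #H, ∑ s ∈ I i, wSet (packingUnions (𝒜 i) (s + 1)) (p / L) := by
          refine (sum_biUnion_le_sum _ _ _ hpow).trans (sum_le_sum fun i _ => ?_)
          exact sum_biUnion_le_sum _ _ _ hpow
      _ ≤ ∑ i ∈ range #H, ∑ s ∈ I i, (1 / 2) * (2 ^ i)⁻¹ * ((1 / 2) * (2 ^ s)⁻¹) * W :=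
          sum_le_sum fun i _ => sum_le_sum (hpack i)
      _ ≤ ∑ i ∈ range #H, (1 / 2) * (2 ^ i)⁻¹ * W := by
          refine sum_le_sum fun i _ => ?_
          rw [← sum_mul, ← mul_sum, ← mul_sum]
          have h1 : ∑ s ∈ I i, ((2 : ℝ) ^ s)⁻¹ ≤ 2 :=
            (sum_le_sum_of_subset_of_nonneg (filter_subset _ _) fun s _ _ => by
              positivity).trans (sum_inv_two_pow_lt #(𝒜 i)).le
          refine mul_le_mul_of_nonneg_right ?_ hW0
          refine mul_le_of_le_one_right (by positivity) ?_
          linarith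
      _ ≤ W := by
          rw [← sum_mul, ← mul_sum]
          refine mul_le_of_le_one_left hW0 ?_
          linarith [sum_inv_two_pow_lt #H]

/-- Theorem (linear hypergraphs, unweighted): for `n ≥ k`, `J ≥ 1`, `r > 0`,
`L ≥ 2^{10} e²`, `|X| = n` and `g : (X choose k) → [0,∞)` equal to `1/r` on its support,
with `supp(g)` a linear hypergraph (`Δ₂ ≤ 1`), if `w(g,p) = 1` then there is `G ⊆ 2^X`
with `⟨g⟩_{J,L} ⊆ ⟨G⟩` and `w(G, p/L) ≤ (1/L)^{√(Jr)/2^7}`. -/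
theorem stmt13 {α : Type*} [DecidableEq α] (n k : ℕ) (hk : 0 < k) (hkn : k ≤ n)
    (J r L : ℝ) (hJ : 1 ≤ J) (hr : 0 < r) (hL : 2 ^ 10 * Real.exp 1 ^ 2 ≤ L)
    (X : Finset α) (hX : X.card = n)
    (g : Finset α → ℝ) (hg : ∀ T, 0 ≤ g T)
    (hsupp : ∀ T, g T ≠ 0 → T ⊆ X ∧ T.card = k)
    (hconst : ∀ T, g T ≠ 0 → g T = 1 / r)
    (hlin : ∀ x y : α, x ≠ y →
      (((X.powersetCard k).filter fun T => g T ≠ 0 ∧ x ∈ T ∧ y ∈ T).card ≤ 1))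
    (p : ℝ) (hp0 : 0 ≤ p) (hp1 : p ≤ 1) (hw : wFun X g p = 1) :
    ∃ G : Finset (Finset α), (∀ T ∈ G, T ⊆ X) ∧
      (∀ S ∈ X.powerset, S ∈ coverJL X k g J L → ∃ T ∈ G, T ⊆ S) ∧
      wSet G (p / L) ≤ (1 / L) ^ (Real.sqrt (J * r) / 2 ^ 7) := by
  have he := Real.exp_pos 1
  have hk0 : (0 : ℝ) < k := by exact_mod_cast hk
  set H := (X.powersetCard k).filter fun T => g T ≠ 0 with hH
  have hsum : ∀ A : Finset (Finset α), ∑ T ∈ A, g T = #{T ∈ A | g T ≠ 0} / r := by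
    intro A
    rw [← sum_filter_ne_zero, sum_congr rfl (g := fun _ => 1 / r), sum_const, nsmul_eq_mul,
      mul_one_div]
    intro T hT
    exact hconst T (mem_filter.1 hT).2
  have hHr : #H * p ^ k = r := by
    have h1 : wFun X g p = (∑ T ∈ X.powersetCard k, g T) * p ^ k := by
      rw [wFun, sum_mul]
      refine (sum_subset_zero_on_sdiff ?_ ?_ ?_).symm
      · intro T hT
        exact mem_powerset.2 (mem_powersetCard.1 hT).1
      · intro T hT
        obtain ⟨hT1, hT2⟩ := mem_sdiff.1 hT
        have : g T = 0 := by
          by_contra hne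
          exact hT2 (mem_powersetCard.2 (hsupp T hne))
        rw [this, zero_mul]
      · intro T hT
        rw [(mem_powersetCard.1 hT).2]
    rw [h1, hsum, ← hH, div_mul_eq_mul_div, div_eq_one_iff_eq hr.ne'] at hw
    exact hw
  have hp : 0 < p := by
    refine hp0.lt_of_ne fun h => ?_
    rw [← h, zero_pow hk.ne', mul_zero] at hHr
    exact hr.ne hHr
  have hlin' : ∀ e ∈ H, ∀ f ∈ H, e ≠ f → #(e ∩ f) ≤ 1 := by
    intro e heH f hfH hef
    obtain ⟨he1, he2⟩ := mem_filter.1 heH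
    obtain ⟨hf1, hf2⟩ := mem_filter.1 hfH
    refine card_le_one.2 fun x hx y hy => ?_
    by_contra hxy
    obtain ⟨hxe, hxf⟩ := mem_inter.1 hx
    obtain ⟨hye, hyf⟩ := mem_inter.1 hy
    exact hef (card_le_one.1 (hlin x y hxy) e (mem_filter.2 ⟨he1, he2, hxe, hye⟩) f
      (mem_filter.2 ⟨hf1, hf2, hxf, hyf⟩))
  obtain ⟨G, hGX, hG, hGw⟩ := exists_cover_of_linear X H k hk
    (fun e he => (mem_powersetCard.1 (mem_filter.1 he).1).1)
    (fun e he => (mem_powersetCard.1 (mem_filter.1 he).1).2) hlin' p L (J * r) hp0 hp1 hL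
    (by rw [hHr]; exact hr) (by rw [hHr]; exact le_mul_of_one_le_left hr.le hJ)
  refine ⟨G, hGX, fun S hS hSc => ?_, hGw⟩
  have hSX := mem_powerset.1 hS
  have hES : ∑ T ∈ S.powersetCard k, g T = #{e ∈ H | e ⊆ S} / r := by
    rw [hsum]
    congr 3
    ext T
    simp only [hH, mem_filter, mem_powersetCard]
    constructor
    · rintro ⟨⟨h1, h2⟩, h3⟩
      exact ⟨⟨⟨h1.trans hSX, h2⟩, h3⟩, h1⟩
    · rintro ⟨⟨⟨-, h2⟩, h3⟩, h1⟩
      exact ⟨⟨h1, h2⟩, h3⟩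
  have hdeg : degSum X k g S = (∑ x ∈ S, (#{e ∈ H | x ∈ e} : ℝ)) / r := by
    rw [degSum, sum_div]
    refine sum_congr rfl fun x _ => ?_
    rw [hsum, hH, filter_comm]
  have hpow : (∑ T ∈ X.powersetCard k, g T) ^ (-1 + (k : ℝ)⁻¹) = p ^ (k - 1) := by
    have h1 : ∑ T ∈ X.powersetCard k, g T = p ^ (-(k : ℝ)) := by
      rw [hsum, ← hH, Real.rpow_neg hp0, Real.rpow_natCast, ← hHr]
      have : (#H : ℝ) ≠ 0 := fun h => by
        rw [h, zero_mul] at hHr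
        exact hr.ne hHr
      field_simp
    rw [h1, ← Real.rpow_mul hp0, ← Real.rpow_natCast p (k - 1), Nat.cast_sub hk]
    congr 1
    field_simp
    push_cast
    ring
  simp only [coverJL, Set.mem_ofPred_eq, max_le_iff] at hSc
  rw [hES, hpow, hdeg] at hSc
  refine hG S hSX ((le_div_iff₀ hr).1 hSc.1) ?_
  have h2 := hSc.2
  rw [mul_div_assoc', div_le_div_iff_of_pos_right hr, div_mul_eq_mul_div, div_mul_eq_mul_div,
    div_le_iff₀ (by positivity)] at h2
  linarith
end

section
/- Let X be a finite set, let k, c ∈ ℕ with |X| ≥ k, and let H be a family of k-element subsets of X whose maximum codegree satisfies Δ₂(H) ≤ c^k. Then H can be partitioned into at most (2c)^k pairwise disjoint subfamilies H₁, …, H_m, each of which is a linear k-uniform hypergraph (i.e. Δ₂(H_j) ≤ 1 for every j). -/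
open Finset

/-- Greedy coloring: if every element of `S` is related by the symmetric relation `r` to fewer
than `n` elements of `S`, then `S` has a proper coloring with `n` colors. -/
theorem exists_proper_coloring_of_card_lt {β : Type*} [DecidableEq β] (r : β → β → Prop)
    [DecidableRel r] (hr : ∀ a b, r a b → r b a) (n : ℕ) (hn : 0 < n) (S : Finset β)
    (hS : ∀ a ∈ S, (S.filter (r a)).card < n) :
    ∃ f : β → Fin n, ∀ a ∈ S, ∀ b ∈ S, a ≠ b → r a b → f a ≠ f b := by
  induction S using Finset.induction_on with
  | empty => exact ⟨fun _ => ⟨0, hn⟩, by simp⟩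
  | insert s S hs ih =>
    obtain ⟨f, hf⟩ := ih fun a ha =>
      (card_le_card (filter_subset_filter _ (subset_insert s S))).trans_lt
        (hS a (mem_insert_of_mem ha))
    obtain ⟨i, hi⟩ : ∃ i, i ∉ (S.filter (r s)).image f := by
      by_contra! h
      have h₁ : (univ : Finset (Fin n)).card ≤ ((S.filter (r s)).image f).card :=
        card_le_card fun i _ => h i
      have h₂ : ((S.filter (r s)).image f).card ≤ (S.filter (r s)).card := card_image_le
      have h₃ := card_le_card (filter_subset_filter (r s) (subset_insert s S))
      have h₄ := hS s (mem_insert_self s S)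
      rw [card_univ, Fintype.card_fin] at h₁
      omega
    have hi' : ∀ b ∈ S, r s b → f b ≠ i := fun b hb hsb h =>
      hi (mem_image.2 ⟨b, mem_filter.2 ⟨hb, hsb⟩, h⟩)
    refine ⟨Function.update f s i, fun a ha b hb hab hrab => ?_⟩
    rcases mem_insert.1 ha with rfl | haS
    · have hbS := (mem_insert.1 hb).resolve_left hab.symm
      rw [Function.update_self, Function.update_of_ne hab.symm]
      exact (hi' b hbS hrab).symm
    · have has : a ≠ s := fun h => hs (h ▸ haS)
      rcases mem_insert.1 hb with rfl | hbS
      · rw [Function.update_self, Function.update_of_ne has]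
        exact hi' a haS (hr _ _ hrab)
      · have hbs : b ≠ s := fun h => hs (h ▸ hbS)
        rw [Function.update_of_ne has, Function.update_of_ne hbs]
        exact hf a haS b hbS hab hrab

/-- An edge `e` of a hypergraph with codegrees at most `d` meets at most `(#e choose 2) * d` edges
in two or more vertices. -/
theorem card_filter_two_le_card_inter_le {α : Type*} [DecidableEq α] (H : Finset (Finset α))
    (d : ℕ) (hcodeg : ∀ x y : α, x ≠ y → (H.filter fun e => x ∈ e ∧ y ∈ e).card ≤ d)
    (e : Finset α) :
    (H.filter fun e' => 2 ≤ (e ∩ e').card).card ≤ e.card.choose 2 * d := by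
  have hsub : (H.filter fun e' => 2 ≤ (e ∩ e').card) ⊆
      (e.powersetCard 2).biUnion fun p => H.filter fun e' => p ⊆ e' := by
    intro e' he'
    obtain ⟨he'H, h2⟩ := mem_filter.1 he'
    obtain ⟨p, hp, hp2⟩ := exists_subset_card_eq h2
    exact mem_biUnion.2 ⟨p, mem_powersetCard.2 ⟨hp.trans inter_subset_left, hp2⟩,
      mem_filter.2 ⟨he'H, hp.trans inter_subset_right⟩⟩
  rw [← card_powersetCard]
  refine (card_le_card hsub).trans (card_biUnion_le_card_mul _ _ _ fun p hp => ?_)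
  obtain ⟨x, y, hxy, rfl⟩ := card_eq_two.1 (mem_powersetCard.1 hp).2
  simpa [insert_subset_iff] using hcodeg x y hxy

theorem choose_two_lt_two_pow (k : ℕ) : k.choose 2 < 2 ^ k := by
  induction k with
  | zero => simp
  | succ k ih =>
    have h₁ : (k + 1).choose 2 = k.choose 1 + k.choose 2 := Nat.choose_succ_succ k 1
    have h₂ : k < 2 ^ k := Nat.lt_two_pow_self
    rw [h₁, Nat.choose_one_right, pow_succ]
    omega

/-- Decomposition into linear hypergraphs: if `H` is a family of `k`-element subsets of a
finite set `X` with maximum codegree `Δ₂(H) ≤ c^k`, then `H` can be partitioned into at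
most `(2c)^k` pairwise disjoint subfamilies, each of which is a linear `k`-uniform
hypergraph.  The partition is encoded by a coloring `f : H → Fin ((2c)^k)` each of whose
color classes has maximum codegree at most `1`. -/
theorem stmt15 {α : Type*} [DecidableEq α] (X : Finset α) (k c : ℕ) (hk : 0 < k)
    (hc : 0 < c) (hkX : k ≤ X.card) (H : Finset (Finset α))
    (hH : ∀ e ∈ H, e ⊆ X ∧ e.card = k)
    (hcodeg : ∀ x y : α, x ≠ y → (H.filter fun e => x ∈ e ∧ y ∈ e).card ≤ c ^ k) :
    ∃ f : Finset α → Fin ((2 * c) ^ k),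
      ∀ (j : Fin ((2 * c) ^ k)) (x y : α), x ≠ y →
        ((H.filter fun e => f e = j).filter fun e => x ∈ e ∧ y ∈ e).card ≤ 1 := by
  obtain ⟨f, hf⟩ := exists_proper_coloring_of_card_lt
    (fun e e' : Finset α => 2 ≤ (e ∩ e').card) (fun a b h => by rwa [inter_comm])
    ((2 * c) ^ k) (by positivity) H fun e he => by
      refine (card_filter_two_le_card_inter_le H (c ^ k) hcodeg e).trans_lt ?_
      rw [(hH e he).2, mul_pow]
      exact Nat.mul_lt_mul_of_pos_right (choose_two_lt_two_pow k) (by positivity)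
  refine ⟨f, fun j x y hxy => card_le_one.2 fun a ha b hb => ?_⟩
  simp only [mem_filter] at ha hb
  obtain ⟨⟨haH, haj⟩, hxa, hya⟩ := ha
  obtain ⟨⟨hbH, hbj⟩, hxb, hyb⟩ := hb
  by_contra hab
  refine hf a haH b hbH hab ?_ (haj.trans hbj.symm)
  exact one_lt_card.2 ⟨x, mem_inter.2 ⟨hxa, hxb⟩, y, mem_inter.2 ⟨hya, hyb⟩, hxy⟩
end

section
/- Let X be a finite set, let k ∈ ℕ with |X| ≥ k, let p ∈ [0,1] and let g be a function from the k-element subsets of X to [0,1] such that supp(g) is a linear k-uniform hypergraph (any two distinct vertices lie in at most one member of supp(g)). If w(g, p) = 1 then there exists G ⊆ 2^X with ⟨g⟩ ⊆ ⟨G⟩ and w(G, p/(10⁵·2¹²·e²)) ≤ 1. -/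
open Finset
open scoped Classical

open scoped Nat in
/-- Elementary symmetric sums of a nonnegative family are bounded by the power sum
divided by a factorial. -/
lemma sum_powersetCard_prod_le_s16 {ι : Type*} [DecidableEq ι] (s : Finset ι) (a : ι → ℝ)
    (ha : ∀ x, 0 ≤ a x) (c : ℕ) :
    ∑ F ∈ s.powersetCard c, ∏ x ∈ F, a x ≤ (∑ x ∈ s, a x) ^ c / c ! := by
  induction s using Finset.induction_on generalizing c with
  | empty => cases c with
    | zero => simp
    | succ c => rw [powersetCard_eq_empty.2 (by simp)]; simp
  | insert x s hx ih =>
    cases c with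
    | zero => simp
    | succ c =>
      have hs : 0 ≤ ∑ y ∈ s, a y := sum_nonneg fun y _ => ha y
      have hinj : ∑ F ∈ (s.powersetCard c).image (insert x), ∏ y ∈ F, a y
          = a x * ∑ F ∈ s.powersetCard c, ∏ y ∈ F, a y := by
        rw [sum_image, mul_sum]
        · refine sum_congr rfl fun F hF => ?_
          rw [prod_insert fun h => hx ((mem_powersetCard.1 hF).1 h)]
        · intro F hF F' hF' h
          have h1 : x ∉ F := fun h => hx ((mem_powersetCard.1 hF).1 h)
          have h2 : x ∉ F' := fun h => hx ((mem_powersetCard.1 hF').1 h)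
          rw [← erase_insert h1, ← erase_insert h2]
          exact congrArg (fun A => A.erase x) h
      rw [powersetCard_succ_insert hx, sum_union, hinj, sum_insert hx]
      · refine (add_le_add (ih (c + 1)) (mul_le_mul_of_nonneg_left (ih c) (ha x))).trans ?_
        have hb : (∑ y ∈ s, a y) ^ (c + 1) + (c + 1) * (a x * (∑ y ∈ s, a y) ^ c)
            ≤ (a x + ∑ y ∈ s, a y) ^ (c + 1) := by
          have := pow_add_mul_le_add_pow hs
            (by linarith [ha x] : 0 ≤ 2 * (∑ y ∈ s, a y) + a x) (c + 1)
          rw [add_tsub_cancel_right] at this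
          push_cast at this
          rw [add_comm (a x)]
          linarith
        rw [Nat.factorial_succ]
        push_cast
        rw [div_add' _ _ _ (by positivity), div_le_div_iff_of_pos_right (by positivity)]
        calc _ = (∑ y ∈ s, a y) ^ (c + 1) + (c + 1) * (a x * (∑ y ∈ s, a y) ^ c) := by
              field_simp
          _ ≤ _ := hb
      · rw [disjoint_left]
        rintro F hF hF'
        obtain ⟨F₀, -, rfl⟩ := mem_image.1 hF'
        exact hx ((mem_powersetCard.1 hF).1 (mem_insert_self x F₀))

/-- The sets that are unions of `c` pairwise disjoint members of `B`. -/
noncomputable def disjointUnions {α : Type*} [DecidableEq α] (B : Finset (Finset α)) (c : ℕ) :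
    Finset (Finset α) :=
  ((B.powersetCard c).filter fun F : Finset (Finset α) =>
    (F : Set (Finset α)).PairwiseDisjoint id).image
    fun F : Finset (Finset α) => F.sup id

lemma sum_biUnion_le_sum_real {ι κ : Type*} [DecidableEq κ] (s : Finset ι) (f : ι → Finset κ)
    (w : κ → ℝ) (hw : ∀ y, 0 ≤ w y) : ∑ y ∈ s.biUnion f, w y ≤ ∑ x ∈ s, ∑ y ∈ f x, w y := by
  classical
  induction s using Finset.induction_on with
  | empty => simp
  | insert x s hx ih =>
    rw [biUnion_insert, sum_insert hx]
    have := sum_union_inter (s₁ := f x) (s₂ := s.biUnion f) (f := w)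
    have h0 : 0 ≤ ∑ y ∈ f x ∩ s.biUnion f, w y := sum_nonneg fun y _ => hw y
    linarith

open scoped Nat in
lemma wSet_disjointUnions_le {α : Type*} [DecidableEq α] (B : Finset (Finset α)) (c : ℕ)
    {q : ℝ} (hq : 0 ≤ q) : wSet (disjointUnions B c) q ≤ (wSet B q) ^ c / c ! := by
  refine le_trans ?_ (sum_powersetCard_prod_le_s16 B (fun T => q ^ T.card) (fun _ => by positivity) c)
  refine (sum_image_le_of_nonneg fun _ _ => by positivity).trans ?_
  refine le_trans ?_ (sum_le_sum_of_subset_of_nonneg (s := (B.powersetCard c).filter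
    fun F : Finset (Finset α) => (F : Set (Finset α)).PairwiseDisjoint id) (filter_subset _ _)
    fun F _ _ => prod_nonneg fun _ _ => by positivity)
  refine (sum_congr rfl fun F hF => ?_).le
  rw [prod_pow_eq_pow_sum, sup_eq_biUnion, card_biUnion]
  · rfl
  · intro x hx y hy hxy
    exact (mem_filter.1 hF).2 hx hy hxy

lemma sum_geometric_le (r : ℝ) (h0 : 0 ≤ r) (h1 : r < 1) (s : Finset ℕ) :
    ∑ i ∈ s, r ^ i ≤ (1 - r)⁻¹ := by
  rw [← tsum_geometric_of_lt_one h0 h1]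
  exact (summable_geometric_of_lt_one h0 h1).sum_le_tsum s fun _ _ => by positivity

open scoped Nat in
/-- A union of families of disjoint unions, indexed by triples `(i, J, c)`, with geometrically
decaying weights, has total weight at most `1 / 2`. -/
lemma exists_cover_of_blocks {α : Type*} [DecidableEq α] (X : Finset α) {q : ℝ} (hq : 0 ≤ q)
    (B : ℕ → ℕ → Finset (Finset α)) (R : ℕ → ℕ → ℕ → Prop)
    (hR : ∀ i J c, R i J c → 1 ≤ J ∧ 1 ≤ c ∧
      (wSet (B i J) q) ^ c / c ! ≤ 16 * (2 / 3) ^ i * (1 / 1000) ^ c * (1 / 1000) ^ J) :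
    ∃ G : Finset (Finset α), (∀ T ∈ G, T ⊆ X) ∧ wSet G q ≤ 1 / 2 ∧
      ∀ i J c, R i J c → ∀ T ∈ disjointUnions (B i J) c, T ⊆ X → T ∈ G := by
  classical
  set G : Finset (Finset α) :=
    X.powerset.filter fun T => ∃ i J c, R i J c ∧ T ∈ disjointUnions (B i J) c with hG
  refine ⟨G, fun T hT => mem_powerset.1 (mem_filter.1 hT).1, ?_, fun i J c h T hT hTX =>
    mem_filter.2 ⟨mem_powerset.2 hTX, i, J, c, h, hT⟩⟩
  have hch : ∀ T : Finset α, ∃ i J c, T ∈ G → R i J c ∧ T ∈ disjointUnions (B i J) c := by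
    intro T
    by_cases hT : T ∈ G
    · obtain ⟨i, J, c, h⟩ := (mem_filter.1 hT).2
      exact ⟨i, J, c, fun _ => h⟩
    · exact ⟨0, 0, 0, fun h => absurd h hT⟩
  choose i J c h using hch
  set P := ((G.image i) ×ˢ (G.image J) ×ˢ (G.image c)).filter fun x => R x.1 x.2.1 x.2.2 with hP
  have hsub : G ⊆ P.biUnion fun x => disjointUnions (B x.1 x.2.1) x.2.2 := by
    intro T hT
    refine mem_biUnion.2 ⟨(i T, J T, c T), mem_filter.2 ⟨?_, (h T hT).1⟩, (h T hT).2⟩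
    simp only [mem_product]
    exact ⟨mem_image_of_mem _ hT, mem_image_of_mem _ hT, mem_image_of_mem _ hT⟩
  have hgeo : ∀ s : Finset ℕ, ∑ j ∈ s.filter (1 ≤ ·), (1 / 1000 : ℝ) ^ j ≤ 1 / 999 := by
    intro s
    have h1 := sum_geometric_le (1 / 1000) (by norm_num) (by norm_num)
      (insert 0 (s.filter (1 ≤ ·)))
    rw [sum_insert (by simp)] at h1
    norm_num at h1 ⊢
    linarith
  calc wSet G q ≤ ∑ x ∈ P, wSet (disjointUnions (B x.1 x.2.1) x.2.2) q :=
        (sum_le_sum_of_subset_of_nonneg hsub fun _ _ _ => by positivity).trans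
          (sum_biUnion_le_sum_real _ _ _ fun _ => by positivity)
    _ ≤ ∑ x ∈ P, 16 * (2 / 3 : ℝ) ^ x.1 * (1 / 1000) ^ x.2.2 * (1 / 1000) ^ x.2.1 :=
        sum_le_sum fun x hx => (wSet_disjointUnions_le _ _ hq).trans
          (hR _ _ _ (mem_filter.1 hx).2).2.2
    _ ≤ ∑ x ∈ (G.image i) ×ˢ ((G.image J).filter (1 ≤ ·)) ×ˢ ((G.image c).filter (1 ≤ ·)),
          16 * (2 / 3 : ℝ) ^ x.1 * (1 / 1000) ^ x.2.2 * (1 / 1000) ^ x.2.1 := by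
        refine sum_le_sum_of_subset_of_nonneg (fun x hx => ?_) fun _ _ _ => by positivity
        have h2 := hR _ _ _ (mem_filter.1 hx).2
        have h3 := (mem_filter.1 hx).1
        simp only [mem_product, mem_filter] at h3 ⊢
        exact ⟨h3.1, ⟨h3.2.1, h2.1⟩, h3.2.2, h2.2.1⟩
    _ = 16 * (∑ a ∈ G.image i, (2 / 3 : ℝ) ^ a) *
          ((∑ b ∈ (G.image J).filter (1 ≤ ·), (1 / 1000 : ℝ) ^ b) *
            ∑ b ∈ (G.image c).filter (1 ≤ ·), (1 / 1000 : ℝ) ^ b) := by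
        rw [sum_product]
        simp only [sum_product]
        rw [mul_sum, sum_mul]
        refine sum_congr rfl fun a _ => ?_
        rw [sum_mul_sum, mul_sum]
        refine sum_congr rfl fun b _ => ?_
        rw [mul_sum]
        exact sum_congr rfl fun d _ => by ring
    _ ≤ 16 * (1 - 2 / 3)⁻¹ * (1 / 999 * (1 / 999)) := by
        gcongr
        · exact sum_geometric_le _ (by norm_num) (by norm_num) _
        · exact hgeo _
        · exact hgeo _
    _ ≤ 1 / 2 := by norm_num

/-- The members of `Y` on which `g` lies in `(2 ^ (-i - 1), 2 ^ (-i)]`. -/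
noncomputable def dyadicLevel {ι : Type*} (Y : Finset ι) (g : ι → ℝ) (i : ℕ) : Finset ι :=
  Y.filter fun y => (1 / 2 : ℝ) ^ (i + 1) < g y ∧ g y ≤ (1 / 2) ^ i

lemma pairwise_disjoint_dyadicLevel {ι : Type*} (Y : Finset ι) (g : ι → ℝ) :
    Pairwise fun i j => Disjoint (dyadicLevel Y g i) (dyadicLevel Y g j) := by
  have key : ∀ i j, i < j → Disjoint (dyadicLevel Y g i) (dyadicLevel Y g j) := by
    intro i j hij
    rw [disjoint_left]
    intro y hi hj
    have h1 := (mem_filter.1 hi).2.1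
    have h2 := (mem_filter.1 hj).2.2
    have h3 : (1 / 2 : ℝ) ^ j ≤ (1 / 2) ^ (i + 1) :=
      pow_le_pow_of_le_one (by norm_num) (by norm_num) hij
    linarith
  intro i j hij
  rcases lt_or_gt_of_ne hij with h | h
  · exact key i j h
  · exact (key j i h).symm

/-- If `A ⊆ Y` carries `g`-mass at least `1`, then on some dyadic level of `g` it is large
compared with a penalty `r` of small total `g`-mass, and large in absolute terms. -/
lemma exists_large_dyadicLevel {ι : Type*} (Y A : Finset ι) (g r : ι → ℝ)
    (hg : ∀ y, 0 ≤ g y ∧ g y ≤ 1) (hr : ∀ y, 0 ≤ r y)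
    (hrg : ∑ y ∈ Y, r y * g y ≤ 1 / 8) (hA : 1 ≤ ∑ y ∈ A, g y) :
    ∃ i : ℕ, ∑ y ∈ dyadicLevel Y g i, r y ≤ ((dyadicLevel A g i).card : ℝ) ∧
      (3 / 2 : ℝ) ^ i / 8 ≤ ((dyadicLevel A g i).card : ℝ) := by
  classical
  by_contra! hcon
  have hlev : ∀ y, ∃ i : ℕ, 0 < g y → (1 / 2 : ℝ) ^ (i + 1) < g y ∧ g y ≤ (1 / 2) ^ i := by
    intro y
    by_cases hy : 0 < g y
    · obtain ⟨i, hi⟩ := exists_nat_pow_near_of_lt_one hy (hg y).2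
        (by norm_num : (0 : ℝ) < 1 / 2) (by norm_num)
      exact ⟨i, fun _ => hi⟩
    · exact ⟨0, fun h => absurd h hy⟩
  choose l hl using hlev
  set I := (A.filter fun y => 0 < g y).image l with hI
  have h1 : ∑ y ∈ A, g y ≤ ∑ i ∈ I, ((dyadicLevel A g i).card : ℝ) * (1 / 2) ^ i := by
    calc ∑ y ∈ A, g y = ∑ y ∈ A.filter (fun y => 0 < g y), g y := by
          rw [sum_filter]
          refine sum_congr rfl fun y _ => ?_
          split_ifs with h
          · rfl
          · exact le_antisymm (not_lt.1 h) (hg y).1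
      _ = ∑ i ∈ I, ∑ y ∈ (A.filter fun y => 0 < g y).filter (fun y => l y = i), g y :=
          (sum_fiberwise_of_maps_to (fun y hy => mem_image_of_mem l hy) _).symm
      _ ≤ ∑ i ∈ I, ∑ y ∈ dyadicLevel A g i, g y := by
          refine sum_le_sum fun i _ => sum_le_sum_of_subset_of_nonneg ?_ fun y _ _ => (hg y).1
          intro y hy
          simp only [mem_filter] at hy
          obtain ⟨⟨hyA, hy0⟩, rfl⟩ := hy
          exact mem_filter.2 ⟨hyA, hl y hy0⟩
      _ ≤ _ := by
          refine sum_le_sum fun i _ => ?_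
          rw [← nsmul_eq_mul]
          exact sum_le_card_nsmul _ _ _ fun y hy => (mem_filter.1 hy).2.2
  have h2 : ∀ i, ((dyadicLevel A g i).card : ℝ) * (1 / 2) ^ i ≤
      2 * ∑ y ∈ dyadicLevel Y g i, r y * g y + (1 / 8) * (3 / 4) ^ i := by
    intro i
    have h3 : ((dyadicLevel A g i).card : ℝ) ≤
        ∑ y ∈ dyadicLevel Y g i, r y + (3 / 2 : ℝ) ^ i / 8 := by
      have h0 : 0 ≤ ∑ y ∈ dyadicLevel Y g i, r y := sum_nonneg fun y _ => hr y
      have h0' : 0 ≤ (3 / 2 : ℝ) ^ i / 8 := by positivity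
      rcases le_or_gt (∑ y ∈ dyadicLevel Y g i, r y) ((dyadicLevel A g i).card : ℝ) with h | h
      · linarith [hcon i h]
      · linarith
    have h4 : (∑ y ∈ dyadicLevel Y g i, r y) * (1 / 2) ^ i ≤
        2 * ∑ y ∈ dyadicLevel Y g i, r y * g y := by
      rw [sum_mul, mul_sum]
      refine sum_le_sum fun y hy => ?_
      have h5 := (mem_filter.1 hy).2.1
      rw [pow_succ] at h5
      have h6 := mul_le_mul_of_nonneg_left h5.le (hr y)
      linarith
    have h7 : (3 / 4 : ℝ) ^ i = (3 / 2) ^ i * (1 / 2) ^ i := by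
      rw [← mul_pow]; norm_num
    rw [h7]
    have h8 := mul_le_mul_of_nonneg_right h3 (by positivity : (0 : ℝ) ≤ (1 / 2) ^ i)
    linarith
  have h9 : ∑ i ∈ I, ∑ y ∈ dyadicLevel Y g i, r y * g y ≤ 1 / 8 := by
    refine le_trans ?_ hrg
    rw [← sum_biUnion fun i _ j _ hij => pairwise_disjoint_dyadicLevel Y g hij]
    refine sum_le_sum_of_subset_of_nonneg ?_ fun y _ _ => mul_nonneg (hr y) (hg y).1
    exact biUnion_subset.2 fun i _ => filter_subset _ _
  have h10 := sum_geometric_le (3 / 4) (by norm_num) (by norm_num) I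
  have h11 := h1.trans (sum_le_sum fun i _ => h2 i)
  rw [sum_add_distrib, ← mul_sum, ← mul_sum] at h11
  norm_num at h10
  linarith

/-- Unions of `J` members of `E` through a common vertex `v ∈ V` with `f v ≤ J`. -/
noncomputable def starBlocks {α : Type*} [DecidableEq α] (E : Finset (Finset α)) (V : Finset α)
    (f : α → ℝ) (J : ℕ) : Finset (Finset α) :=
  (V.filter fun v => f v ≤ J).biUnion fun v =>
    ((E.filter fun e => v ∈ e).powersetCard J).image fun P : Finset (Finset α) => P.sup id

lemma mem_starBlocks {α : Type*} [DecidableEq α] {E : Finset (Finset α)} {V : Finset α}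
    {f : α → ℝ} {J : ℕ} {B : Finset α} :
    B ∈ starBlocks E V f J ↔ ∃ v ∈ V, f v ≤ J ∧ ∃ P : Finset (Finset α),
      P ⊆ E.filter (fun e => v ∈ e) ∧ P.card = J ∧ P.sup id = B := by
  simp only [starBlocks, mem_biUnion, mem_filter, mem_image, mem_powersetCard, and_assoc]

lemma starBlocks_mono {α : Type*} [DecidableEq α] {E E' : Finset (Finset α)} {V V' : Finset α}
    (hE : E ⊆ E') (hV : V ⊆ V') (f : α → ℝ) (J : ℕ) :
    starBlocks E V f J ⊆ starBlocks E' V' f J := by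
  intro B hB
  obtain ⟨v, hv, hf, P, hP, hJ, rfl⟩ := mem_starBlocks.1 hB
  exact mem_starBlocks.2 ⟨v, hV hv, hf, P, hP.trans (filter_subset_filter _ hE), hJ, rfl⟩

/-- A `k`-uniform hypergraph in which there are at most `C J` pairwise disjoint stars with `J`
edges and `f`-admissible centre, for every `J`, has few edges. -/
lemma card_le_of_disjoint_stars {α : Type*} [DecidableEq α] {k : ℕ} (hk : 0 < k) (f : α → ℝ)
    (hf : ∀ v, 0 ≤ f v) (C : ℕ → ℝ) (D : ℕ) (V : Finset α) (H : Finset (Finset α))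
    (hH : ∀ e ∈ H, e ⊆ V ∧ e.card = k)
    (hD : ∀ v, (H.filter fun e => v ∈ e).card ≤ D)
    (hC : ∀ J ∈ Icc 1 D, ∀ F ⊆ starBlocks H V f J,
      (F : Set (Finset α)).PairwiseDisjoint id → (F.card : ℝ) ≤ C J) :
    (H.card : ℝ) ≤ ∑ J ∈ Icc 1 D, C J * k * J ^ 2 + ∑ v ∈ V, f v := by
  induction D generalizing V H with
  | zero =>
    have : H = ∅ := by
      refine eq_empty_of_forall_notMem fun e he => ?_
      obtain ⟨v, hv⟩ := card_pos.1 ((hH e he).2.symm ▸ hk)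
      have := card_pos.2 ⟨e, (mem_filter.2 ⟨he, hv⟩ : e ∈ H.filter fun e => v ∈ e)⟩
      exact absurd (hD v) (by omega)
    simpa [this] using sum_nonneg fun v (_ : v ∈ V) => hf v
  | succ D ih =>
    obtain ⟨F, hF, hmax⟩ := exists_max_image ((starBlocks H V f (D + 1)).powerset.filter
      fun F : Finset (Finset α) => (F : Set (Finset α)).PairwiseDisjoint id) card
      ⟨∅, by simp⟩
    simp only [mem_filter, mem_powerset] at hF hmax
    obtain ⟨hFs, hFd⟩ := hF
    set U := F.sup id with hU
    set Bd := V.filter fun v => (D + 1 : ℝ) < f v with hBd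
    set H' := H.filter fun e => Disjoint e (Bd ∪ U) with hH'
    have hU' : (U.card : ℝ) ≤ C (D + 1) * (k * (D + 1)) := by
      have h1 : U.card ≤ F.card * ((D + 1) * k) := by
        rw [hU, sup_eq_biUnion]
        refine card_biUnion_le_card_mul _ _ _ fun B hB => ?_
        obtain ⟨v, -, -, P, hP, hJ, rfl⟩ := mem_starBlocks.1 (hFs hB)
        rw [← hJ, id, sup_eq_biUnion]
        exact card_biUnion_le_card_mul _ _ _ fun e he =>
          (hH e (filter_subset _ _ (hP he))).2.le
      have h2 := hC (D + 1) (mem_Icc.2 ⟨by omega, le_rfl⟩) F hFs hFd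
      calc (U.card : ℝ) ≤ F.card * ((D + 1) * k) := by exact_mod_cast h1
        _ ≤ C (D + 1) * ((D + 1) * k) := by gcongr
        _ = _ := by ring
    have hBd' : (Bd.card : ℝ) * (D + 1) ≤ ∑ v ∈ Bd, f v := by
      rw [← nsmul_eq_mul]
      exact card_nsmul_le_sum _ _ _ fun v hv => (mem_filter.1 hv).2.le
    have hcard : (H.card : ℝ) ≤ H'.card + (Bd.card + U.card) * (D + 1) := by
      have h1 : (H.filter fun e => ¬ Disjoint e (Bd ∪ U)) ⊆
          (Bd ∪ U).biUnion fun v => H.filter fun e => v ∈ e := by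
        intro e he
        obtain ⟨heH, hd⟩ := mem_filter.1 he
        obtain ⟨v, hv, hv'⟩ := not_disjoint_iff.1 hd
        exact mem_biUnion.2 ⟨v, hv', mem_filter.2 ⟨heH, hv⟩⟩
      have h2 := (card_le_card h1).trans (card_biUnion_le_card_mul _ _ (D + 1) fun v _ => hD v)
      have h3 := card_filter_add_card_filter_not (s := H) fun e => Disjoint e (Bd ∪ U)
      have h4 := Nat.mul_le_mul_right (D + 1) (card_union_le Bd U)
      have h5 : H.card ≤ H'.card + (Bd.card + U.card) * (D + 1) := by
        rw [hH']; omega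
      exact_mod_cast h5
    have hrec := ih (V \ Bd) H' (fun e he => ?_) (fun v => ?_) (fun J hJ F hF hFd => ?_)
    · rw [sum_Icc_succ_top (by omega), ← sum_sdiff (filter_subset _ _ : Bd ⊆ V)]
      have h6 : (U.card : ℝ) * (D + 1) ≤ C (D + 1) * (k * (D + 1)) * (D + 1) := by gcongr
      push_cast
      linarith
    · obtain ⟨heH, hd⟩ := mem_filter.1 he
      refine ⟨fun v hv => mem_sdiff.2 ⟨(hH e heH).1 hv, fun hb => ?_⟩, (hH e heH).2⟩
      exact disjoint_left.1 hd hv (mem_union_left _ hb)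
    · by_contra! hlt
      have hle : (H'.filter fun e => v ∈ e).card ≤ D + 1 :=
        (card_le_card (filter_subset_filter _ (filter_subset _ _))).trans (hD v)
      have heq : (H'.filter fun e => v ∈ e).card = D + 1 := by omega
      obtain ⟨e, he⟩ := card_pos.1 (by omega : 0 < (H'.filter fun e => v ∈ e).card)
      obtain ⟨heH', hve⟩ := mem_filter.1 he
      have hvV : v ∈ V := (hH e (filter_subset _ _ heH')).1 hve
      have hfv : f v ≤ (D + 1 : ℕ) := by
        by_contra! h
        push_cast at h
        exact disjoint_left.1 (mem_filter.1 heH').2 hve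
          (mem_union_left _ (mem_filter.2 ⟨hvV, h⟩))
      set B := (H'.filter fun e => v ∈ e).sup id with hB
      have hvB : v ∈ B := by
        rw [hB, mem_sup]
        exact ⟨e, he, hve⟩
      have hBs : B ∈ starBlocks H V f (D + 1) := mem_starBlocks.2
        ⟨v, hvV, hfv, _, filter_subset_filter _ (filter_subset _ _), heq, rfl⟩
      have hBU : Disjoint B U := by
        rw [hB, Finset.disjoint_sup_left]
        intro e he
        exact (mem_filter.1 (mem_filter.1 he).1).2.mono_right subset_union_right
      have hBF : ∀ B' ∈ F, Disjoint B B' := fun B' hB' =>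
        hBU.mono_right (le_sup (f := id) hB')
      have hnot : B ∉ F := fun h => disjoint_left.1 (hBF B h) hvB hvB
      have := hmax (insert B F) ⟨insert_subset hBs hFs, by
        rw [coe_insert]
        exact hFd.insert fun B' hB' _ => hBF B' hB'⟩
      rw [card_insert_of_notMem hnot] at this
      omega
    · exact hC J (mem_Icc.2 ⟨(mem_Icc.1 hJ).1, by have := (mem_Icc.1 hJ).2; omega⟩) F
        (hF.trans (starBlocks_mono (filter_subset _ _) sdiff_subset f J)) hFd

lemma sup_mem_disjointUnions {α : Type*} [DecidableEq α] {B F : Finset (Finset α)}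
    (hF : F ⊆ B) (hd : (F : Set (Finset α)).PairwiseDisjoint id) :
    F.sup id ∈ disjointUnions B F.card :=
  mem_image.2 ⟨F, mem_filter.2 ⟨mem_powersetCard.2 ⟨hF, rfl⟩, hd⟩, rfl⟩

lemma exists_disjoint_stars {α : Type*} [DecidableEq α] {k : ℕ} (hk : 0 < k) (f : α → ℝ)
    (hf : ∀ v, 0 ≤ f v) (V : Finset α) (H : Finset (Finset α))
    (hH : ∀ e ∈ H, e ⊆ V ∧ e.card = k) (hpos : (0 : ℝ) < H.card)
    (hsum : 2 * ∑ v ∈ V, f v ≤ H.card) :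
    ∃ J, 1 ≤ J ∧ ∃ F ⊆ starBlocks H V f J, (F : Set (Finset α)).PairwiseDisjoint id ∧
      (H.card : ℝ) ≤ 4 * F.card * k * J ^ 2 * 2 ^ J := by
  by_contra! hcon
  have hk' : (0 : ℝ) < k := by exact_mod_cast hk
  have h1 := card_le_of_disjoint_stars hk f hf
    (fun J => (H.card : ℝ) / (4 * k * J ^ 2 * 2 ^ J)) H.card V H hH
    (fun v => card_le_card (filter_subset _ _)) (fun J hJ F hF hd => by
      have hJ1 := (mem_Icc.1 hJ).1
      have hJ' : (0 : ℝ) < J := by exact_mod_cast hJ1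
      have := hcon J hJ1 F hF hd
      rw [le_div_iff₀ (by positivity)]
      linarith)
  have h2 : ∑ J ∈ Icc 1 H.card, (H.card : ℝ) / (4 * k * J ^ 2 * 2 ^ J) * k * J ^ 2
      = H.card / 4 * ∑ J ∈ Icc 1 H.card, (1 / 2 : ℝ) ^ J := by
    rw [mul_sum]
    refine sum_congr rfl fun J hJ => ?_
    have hJ' : (0 : ℝ) < J := by exact_mod_cast (mem_Icc.1 hJ).1
    rw [one_div, inv_pow]
    field_simp
  have h3 := sum_geometric_le (1 / 2) (by norm_num) (by norm_num) (insert 0 (Icc 1 H.card))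
  rw [sum_insert (by simp)] at h3
  norm_num at h3
  norm_num at h2
  rw [h2] at h1
  have h4 : ∑ J ∈ Icc 1 H.card, (1 / 2 : ℝ) ^ J ≤ 1 := by norm_num; linarith
  norm_num at h4
  have h5 := mul_le_mul_of_nonneg_left h4 (by positivity : (0 : ℝ) ≤ H.card / 4)
  linarith

/-- In a linear hypergraph the edges of a star meet only in its centre. -/
lemma card_sup_of_star {α : Type*} [DecidableEq α] {k : ℕ} {P : Finset (Finset α)} {v : α}
    (hne : P.Nonempty) (hP : ∀ e ∈ P, v ∈ e ∧ e.card = k)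
    (hlin : ∀ e ∈ P, ∀ e' ∈ P, e ≠ e' → ∀ y ∈ e, y ∈ e' → y = v) :
    (P.sup id).card = (k - 1) * P.card + 1 := by
  have h1 : P.sup id = insert v (P.biUnion fun e => e.erase v) := by
    ext y
    simp only [mem_sup, id, mem_insert, mem_biUnion, mem_erase]
    constructor
    · rintro ⟨e, he, hy⟩
      by_cases h : y = v
      · exact Or.inl h
      · exact Or.inr ⟨e, he, h, hy⟩
    · rintro (rfl | ⟨e, he, -, hy⟩)
      · obtain ⟨e, he⟩ := hne
        exact ⟨e, he, (hP e he).1⟩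
      · exact ⟨e, he, hy⟩
  rw [h1, card_insert_of_notMem (by simp), card_biUnion]
  · rw [sum_congr rfl fun e he => by rw [card_erase_of_mem (hP e he).1, (hP e he).2],
      sum_const, smul_eq_mul, mul_comm]
  · intro e he e' he' hee
    change Disjoint (e.erase v) (e'.erase v)
    rw [disjoint_left]
    intro y hy hy'
    exact (mem_erase.1 hy).1
      (hlin e he e' he' hee y (mem_erase.1 hy).2 (mem_erase.1 hy').2)

lemma sum_degree_le {α : Type*} [DecidableEq α] {k : ℕ} (E : Finset (Finset α)) (V : Finset α)
    (hE : ∀ e ∈ E, e.card = k) :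
    ∑ v ∈ V, (E.filter fun e => v ∈ e).card ≤ k * E.card := by
  have h1 : ∑ v ∈ V, (E.filter fun e => v ∈ e).card = ∑ e ∈ E, (V.filter fun v => v ∈ e).card :=
    sum_card_bipartiteAbove_eq_sum_card_bipartiteBelow (fun v e => v ∈ e)
  rw [h1, mul_comm, ← smul_eq_mul]
  refine sum_le_card_nsmul _ _ _ fun e he => ?_
  rw [← hE e he]
  exact card_le_card fun v hv => (mem_filter.1 hv).2

lemma choose_mul_pow_le_s16 {d J : ℕ} {lam : ℝ} (hlam : 0 ≤ lam) (hJ : 1 ≤ J)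
    (h : lam * d ≤ J) : (d.choose J : ℝ) * lam ^ (J - 1) ≤ d * Real.exp 1 ^ J := by
  have h1 : (d.choose J : ℝ) ≤ (d : ℝ) ^ J / J.factorial := Nat.choose_le_pow_div J d
  have h2 : (J : ℝ) ^ J / J.factorial ≤ Real.exp J :=
    Real.pow_div_factorial_le_exp _ (by positivity) J
  have hJ1 : (1 : ℝ) ≤ J := by exact_mod_cast hJ
  rw [← Real.exp_nat_mul, mul_one]
  calc (d.choose J : ℝ) * lam ^ (J - 1) ≤ (d : ℝ) ^ J / J.factorial * lam ^ (J - 1) := by gcongr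
    _ = d * ((lam * d) ^ (J - 1) / J.factorial) := by
        obtain ⟨j, rfl⟩ := Nat.exists_eq_add_of_le' hJ
        rw [add_tsub_cancel_right, mul_pow, pow_succ]
        ring
    _ ≤ d * ((J : ℝ) ^ (J - 1) / J.factorial) := by gcongr
    _ ≤ d * ((J : ℝ) ^ J / J.factorial) := by
        gcongr
        omega
    _ ≤ d * Real.exp J := by gcongr

lemma wSet_starBlocks_mul_pow_le {α : Type*} [DecidableEq α] {k J : ℕ} (E : Finset (Finset α))
    (V : Finset α) (hE : ∀ e ∈ E, e.card = k)
    (hlin : ∀ e ∈ E, ∀ e' ∈ E, e ≠ e' → ∀ x ∈ e, x ∈ e' → ∀ y ∈ e, y ∈ e' → y = x)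
    (hJ : 1 ≤ J) {lam q : ℝ} (hlam : 0 ≤ lam) (hq : 0 ≤ q) :
    wSet (starBlocks E V (fun v => lam * (E.filter fun e => v ∈ e).card) J) q * lam ^ (J - 1) ≤
      k * E.card * Real.exp 1 ^ J * q ^ ((k - 1) * J + 1) := by
  have h1 : wSet (starBlocks E V (fun v => lam * (E.filter fun e => v ∈ e).card) J) q ≤
      ∑ v ∈ V.filter (fun v => lam * (E.filter fun e => v ∈ e).card ≤ J),
        ((E.filter fun e => v ∈ e).card.choose J : ℝ) * q ^ ((k - 1) * J + 1) := by
    refine (sum_biUnion_le_sum_real _ _ _ fun _ => by positivity).trans (sum_le_sum fun v hv => ?_)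
    refine (sum_image_le_of_nonneg fun _ _ => by positivity).trans (le_of_eq ?_)
    rw [← card_powersetCard, ← nsmul_eq_mul, ← sum_const]
    refine sum_congr rfl fun P hP => ?_
    obtain ⟨hPs, hPJ⟩ := mem_powersetCard.1 hP
    rw [card_sup_of_star (k := k) (v := v) (card_pos.1 (by omega))
      (fun e he => ⟨(mem_filter.1 (hPs he)).2, hE e (mem_filter.1 (hPs he)).1⟩)
      (fun e he e' he' hne => hlin e (mem_filter.1 (hPs he)).1 e' (mem_filter.1 (hPs he')).1 hne v
        (mem_filter.1 (hPs he)).2 (mem_filter.1 (hPs he')).2), hPJ]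
  calc _ ≤ (∑ v ∈ V.filter (fun v => lam * (E.filter fun e => v ∈ e).card ≤ J),
        ((E.filter fun e => v ∈ e).card.choose J : ℝ) * q ^ ((k - 1) * J + 1)) * lam ^ (J - 1) := by
        gcongr
    _ = ∑ v ∈ V.filter (fun v => lam * (E.filter fun e => v ∈ e).card ≤ J),
        ((E.filter fun e => v ∈ e).card.choose J : ℝ) * lam ^ (J - 1) * q ^ ((k - 1) * J + 1) := by
        rw [sum_mul]
        exact sum_congr rfl fun _ _ => by ring
    _ ≤ ∑ v ∈ V.filter (fun v => lam * (E.filter fun e => v ∈ e).card ≤ J),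
        ((E.filter fun e => v ∈ e).card : ℝ) * Real.exp 1 ^ J * q ^ ((k - 1) * J + 1) := by
        refine sum_le_sum fun v hv => ?_
        exact mul_le_mul_of_nonneg_right (choose_mul_pow_le_s16 hlam hJ (mem_filter.1 hv).2)
          (by positivity)
    _ ≤ ∑ v ∈ V,
        ((E.filter fun e => v ∈ e).card : ℝ) * Real.exp 1 ^ J * q ^ ((k - 1) * J + 1) :=
        sum_le_sum_of_subset_of_nonneg (filter_subset _ _) fun _ _ _ => by positivity
    _ = (∑ v ∈ V, (E.filter fun e => v ∈ e).card : ℕ) *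
          Real.exp 1 ^ J * q ^ ((k - 1) * J + 1) := by
        rw [← sum_mul, ← sum_mul]
        push_cast
        rfl
    _ ≤ (k * E.card : ℕ) * Real.exp 1 ^ J * q ^ ((k - 1) * J + 1) := by
        gcongr
        exact sum_degree_le E V hE
    _ = _ := by push_cast; rfl

lemma pow_div_factorial_le_of_le_mul {W x : ℝ} {c : ℕ} (hW : 0 ≤ W) (h : W ≤ c * x)
    (hc : 1 ≤ c) : W ^ c / c.factorial ≤ (3 * x) ^ c := by
  have hc' : (0 : ℝ) < c := by exact_mod_cast hc
  have hx : 0 ≤ x := nonneg_of_mul_nonneg_right (hW.trans h) hc'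
  have h2 : (c : ℝ) ^ c / c.factorial ≤ Real.exp c :=
    Real.pow_div_factorial_le_exp _ (by positivity) c
  rw [← mul_one (c : ℝ), Real.exp_nat_mul, mul_one] at h2
  have h3 : Real.exp 1 ≤ 3 := by linarith [Real.exp_one_lt_d9]
  calc W ^ c / c.factorial ≤ (c * x) ^ c / c.factorial := by gcongr
    _ = (c : ℝ) ^ c / c.factorial * x ^ c := by rw [mul_pow]; ring
    _ ≤ 3 ^ c * x ^ c := by
        gcongr
        exact h2.trans (by gcongr)
    _ = (3 * x) ^ c := (mul_pow _ _ _).symm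

lemma cast_le_two_pow (n : ℕ) : (n : ℝ) ≤ 2 ^ n := by
  exact_mod_cast Nat.lt_two_pow_self.le

lemma one_le_mul_two_thirds_pow {i : ℕ} {x : ℝ} (h : (3 / 2 : ℝ) ^ i / 8 ≤ x) :
    1 ≤ 8 * x * (2 / 3) ^ i := by
  have h1 : (3 / 2 : ℝ) ^ i * (2 / 3) ^ i = 1 := by rw [← mul_pow]; norm_num
  have h2 := mul_le_mul_of_nonneg_right h (by positivity : (0 : ℝ) ≤ (2 / 3) ^ i)
  linarith

lemma two_pow_mul_pow_eq (n : ℕ) : (2 : ℝ) ^ n * (2 ^ n) ^ 2 * 2 ^ n = 16 ^ n := by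
  have h1 : ((2 : ℝ) ^ n) ^ 2 = 4 ^ n := by
    rw [← pow_mul, mul_comm, pow_mul]
    norm_num
  rw [h1, ← mul_pow, ← mul_pow]
  norm_num

lemma star_union_weight_bound {k J c i : ℕ} {a q m W : ℝ} (hk : 2 ≤ k) (hJ : 1 ≤ J) (hc : 1 ≤ c)
    (ha : 0 < a) (hq : 0 ≤ q) (hqa : q ≤ 1 / 10 ^ 8 * a) (hW0 : 0 ≤ W)
    (hm : a ^ k * m ≤ 4 * c * k * J ^ 2 * 2 ^ J)
    (hi : (3 / 2 : ℝ) ^ i / 8 ≤ 4 * c * k * J ^ 2 * 2 ^ J)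
    (hW : W * (a ^ (k - 1)) ^ (J - 1) ≤ k * m * Real.exp 1 ^ J * q ^ ((k - 1) * J + 1)) :
    W ^ c / c.factorial ≤ 16 * (2 / 3) ^ i * (1 / 1000) ^ c * (1 / 1000) ^ J := by
  obtain ⟨j, rfl⟩ := Nat.exists_eq_add_of_le' (by omega : 1 ≤ k)
  rw [add_tsub_cancel_right] at hW
  have hj : 1 ≤ j := by omega
  set n := j * J with hn
  have hjn : j ≤ n := Nat.le_mul_of_pos_right _ hJ
  have hJn : J ≤ n := Nat.le_mul_of_pos_left _ hj
  have hk2 : ((j + 1 : ℕ) : ℝ) ≤ 2 ^ n := by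
    have h1 : j + 1 ≤ 2 ^ j := Nat.lt_two_pow_self
    have h2 : 2 ^ j ≤ 2 ^ n := Nat.pow_le_pow_right (by norm_num) hjn
    exact_mod_cast h1.trans h2
  have hJ2 : (J : ℝ) ≤ 2 ^ n :=
    (cast_le_two_pow J).trans (pow_le_pow_right₀ (by norm_num) hJn)
  have h2J : (2 : ℝ) ^ J ≤ 2 ^ n := pow_le_pow_right₀ (by norm_num) hJn
  have heJ : Real.exp 1 ^ J ≤ 3 ^ n := by
    have h3 : Real.exp 1 ≤ 3 := by linarith [Real.exp_one_lt_d9]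
    calc Real.exp 1 ^ J ≤ 3 ^ J := by gcongr
      _ ≤ 3 ^ n := pow_le_pow_right₀ (by norm_num) hJn
  have hexp : (a ^ j) ^ (J - 1) * a ^ (j + 1) = a ^ (n + 1) := by
    obtain ⟨l, rfl⟩ := Nat.exists_eq_add_of_le' hJ
    rw [← pow_mul, ← pow_add, add_tsub_cancel_right]
    congr 1
  have hWc : W ≤ c * (4 / 10 ^ 8 * (96 / 10 ^ 8) ^ n) := by
    have h1 : W * a ^ (n + 1) ≤ (c * (4 / 10 ^ 8 * (96 / 10 ^ 8) ^ n)) * a ^ (n + 1) := by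
      calc W * a ^ (n + 1) = W * (a ^ j) ^ (J - 1) * a ^ (j + 1) := by rw [← hexp]; ring
        _ ≤ (j + 1 : ℕ) * m * Real.exp 1 ^ J * q ^ (n + 1) * a ^ (j + 1) := by gcongr
        _ = (j + 1 : ℕ) * Real.exp 1 ^ J * q ^ (n + 1) * (a ^ (j + 1) * m) := by ring
        _ ≤ (j + 1 : ℕ) * Real.exp 1 ^ J * q ^ (n + 1) *
              (4 * c * (j + 1 : ℕ) * J ^ 2 * 2 ^ J) := by gcongr
        _ ≤ 2 ^ n * 3 ^ n * (1 / 10 ^ 8 * a) ^ (n + 1) *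
              (4 * c * 2 ^ n * (2 ^ n) ^ 2 * 2 ^ n) := by gcongr
        _ = (c * (4 / 10 ^ 8 * (96 / 10 ^ 8) ^ n)) * a ^ (n + 1) := by
            have h96 : (96 / 10 ^ 8 : ℝ) ^ n =
                2 ^ n * 3 ^ n * (1 / 10 ^ 8) ^ n * (2 ^ n * (2 ^ n) ^ 2 * 2 ^ n) := by
              rw [two_pow_mul_pow_eq, ← mul_pow, ← mul_pow, ← mul_pow]
              norm_num
            rw [h96, pow_succ, mul_pow, pow_succ a]
            ring
    exact le_of_mul_le_mul_right h1 (by positivity)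
  have hone : 1 ≤ (2 / 3 : ℝ) ^ i * (32 * 2 ^ c * (16 ^ n) ^ c) := by
    refine (one_le_mul_two_thirds_pow hi).trans ?_
    rw [mul_comm _ ((2 / 3 : ℝ) ^ i)]
    refine mul_le_mul_of_nonneg_left ?_ (by positivity)
    calc 8 * (4 * c * (j + 1 : ℕ) * (J : ℝ) ^ 2 * 2 ^ J)
        ≤ 8 * (4 * 2 ^ c * 2 ^ n * (2 ^ n) ^ 2 * 2 ^ n) := by
          gcongr
          exact cast_le_two_pow c
      _ = 32 * 2 ^ c * 16 ^ n := by
          rw [← two_pow_mul_pow_eq]; ring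
      _ ≤ 32 * 2 ^ c * (16 ^ n) ^ c := by
          gcongr
          exact le_self_pow₀ (one_le_pow₀ (by norm_num)) (by omega)
  calc W ^ c / c.factorial ≤ (3 * (4 / 10 ^ 8 * (96 / 10 ^ 8) ^ n)) ^ c :=
        pow_div_factorial_le_of_le_mul hW0 hWc hc
    _ ≤ (3 * (4 / 10 ^ 8 * (96 / 10 ^ 8) ^ n)) ^ c *
          ((2 / 3 : ℝ) ^ i * (32 * 2 ^ c * (16 ^ n) ^ c)) :=
        le_mul_of_one_le_right (by positivity) hone
    _ = 32 * (2 / 3) ^ i * (24 / 10 ^ 8) ^ c * ((96 * 16 / 10 ^ 8) ^ n) ^ c := by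
        have h1 : ((96 * 16 / 10 ^ 8 : ℝ) ^ n) ^ c = ((96 / 10 ^ 8) ^ n) ^ c * (16 ^ n) ^ c := by
          rw [← mul_pow, ← mul_pow]
          congr 2
          norm_num
        have h2 : (24 / 10 ^ 8 : ℝ) ^ c = 3 ^ c * (4 / 10 ^ 8) ^ c * 2 ^ c := by
          rw [← mul_pow, ← mul_pow]
          norm_num
        rw [h1, h2, mul_pow, mul_pow]
        ring
    _ ≤ 32 * (2 / 3) ^ i * ((1 / 2) * (1 / 1000) ^ c) * (1 / 1000) ^ J := by
        gcongr
        · calc (24 / 10 ^ 8 : ℝ) ^ c ≤ (1 / 2 * (1 / 1000)) ^ c :=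
                pow_le_pow_left₀ (by norm_num) (by norm_num) _
            _ = (1 / 2) ^ c * (1 / 1000) ^ c := mul_pow _ _ _
            _ ≤ (1 / 2) * (1 / 1000) ^ c := by
                gcongr
                exact pow_le_of_le_one (by norm_num) (by norm_num) (by omega)
        · rw [← pow_mul]
          calc (96 * 16 / 10 ^ 8 : ℝ) ^ (n * c) ≤ (1 / 1000) ^ (n * c) :=
                pow_le_pow_left₀ (by norm_num) (by norm_num) _
            _ ≤ (1 / 1000) ^ J :=
                pow_le_pow_of_le_one (by norm_num) (by norm_num)
                  (hJn.trans (Nat.le_mul_of_pos_right _ hc))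
    _ = _ := by ring

/-- The sets on which a vertex weight `h` is large admit a cheap cover. -/
lemma exists_cover_of_vertex_weights {α : Type*} [DecidableEq α] (X : Finset α) (h : α → ℝ)
    (h0 : ∀ v, 0 ≤ h v) {p q : ℝ} (hp : 0 < p) (hq : 0 ≤ q) (hqp : q ≤ p / 10 ^ 9)
    (hsum : (∑ v ∈ X, h v) * p ≤ 16) :
    ∃ G : Finset (Finset α), (∀ T ∈ G, T ⊆ X) ∧ wSet G q ≤ 1 / 2 ∧
      ∀ S ⊆ X, 1 ≤ ∑ v ∈ S, h v → ∃ T ∈ G, T ⊆ S := by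
  set g : α → ℝ := fun v => min 1 (h v) with hg
  have hg01 : ∀ v, 0 ≤ g v ∧ g v ≤ 1 := fun v => ⟨le_min zero_le_one (h0 v), min_le_left _ _⟩
  obtain ⟨G, hGX, hGw, hG⟩ := exists_cover_of_blocks X hq
    (fun i _ => (dyadicLevel X g i).image fun v => ({v} : Finset α))
    (fun i J c => J = 1 ∧ 1 ≤ c ∧ p / 128 * (dyadicLevel X g i).card ≤ c ∧
      (3 / 2 : ℝ) ^ i / 8 ≤ c) (by
    rintro i J c ⟨rfl, hc, hm, hi⟩
    refine ⟨le_rfl, hc, ?_⟩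
    have hW : wSet ((dyadicLevel X g i).image fun v => ({v} : Finset α)) q ≤
        c * (128 / 10 ^ 9) := by
      refine (sum_image_le_of_nonneg fun _ _ => by positivity).trans ?_
      simp only [card_singleton, pow_one, sum_const, nsmul_eq_mul]
      calc ((dyadicLevel X g i).card : ℝ) * q ≤ (dyadicLevel X g i).card * (p / 10 ^ 9) := by
            gcongr
        _ = (p / 128 * (dyadicLevel X g i).card) * (128 / 10 ^ 9) := by ring
        _ ≤ _ := by gcongr
    have hone : 1 ≤ (2 / 3 : ℝ) ^ i * (8 * 2 ^ c) := by
      refine (one_le_mul_two_thirds_pow hi).trans ?_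
      rw [mul_comm _ ((2 / 3 : ℝ) ^ i)]
      gcongr
      exact cast_le_two_pow c
    calc _ ≤ (3 * (128 / 10 ^ 9)) ^ c :=
          pow_div_factorial_le_of_le_mul (sum_nonneg fun _ _ => by positivity) hW hc
      _ ≤ (3 * (128 / 10 ^ 9)) ^ c * ((2 / 3 : ℝ) ^ i * (8 * 2 ^ c)) :=
          le_mul_of_one_le_right (by positivity) hone
      _ = 8 * (2 / 3) ^ i * (3 * (128 / 10 ^ 9) * 2) ^ c := by rw [mul_pow _ (2 : ℝ)]; ring
      _ ≤ 16 * (2 / 3) ^ i * ((1 / 1000) ^ c * (1 / 1000) ^ c) := by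
          rw [← mul_pow]
          exact mul_le_mul (by gcongr; norm_num) (pow_le_pow_left₀ (by norm_num) (by norm_num) _)
            (by positivity) (by positivity)
      _ ≤ 16 * (2 / 3) ^ i * ((1 / 1000) ^ c * (1 / 1000) ^ 1) := by
          gcongr ?_ * (_ * ?_)
          exact pow_le_pow_of_le_one (by norm_num) (by norm_num) hc
      _ = _ := by ring)
  refine ⟨G, hGX, hGw, fun S hS hS1 => ?_⟩
  have hgS : 1 ≤ ∑ v ∈ S, g v := by
    by_cases hbig : ∃ v ∈ S, 1 ≤ h v
    · obtain ⟨v, hv, hv1⟩ := hbig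
      have : g v = 1 := min_eq_left hv1
      rw [← this]
      exact single_le_sum (fun v _ => (hg01 v).1) hv
    · push Not at hbig
      rwa [sum_congr rfl fun v hv => (min_eq_right (hbig v hv).le : g v = h v)]
  obtain ⟨i, hi1, hi2⟩ := exists_large_dyadicLevel X S g (fun _ => p / 128) hg01
    (fun _ => by positivity) (by
      rw [← mul_sum]
      have : ∑ v ∈ X, g v ≤ ∑ v ∈ X, h v := sum_le_sum fun v _ => min_le_right _ _
      have := mul_le_mul_of_nonneg_right this hp.le
      linarith) hgS
  rw [sum_const, nsmul_eq_mul] at hi1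
  have hc0 : (0 : ℝ) < (dyadicLevel S g i).card := lt_of_lt_of_le (by positivity) hi2
  have hinj : Function.Injective fun v : α => ({v} : Finset α) :=
    fun _ _ => singleton_injective.eq_iff.1
  have hcard : ((dyadicLevel S g i).image fun v => ({v} : Finset α)).card =
      (dyadicLevel S g i).card := card_image_of_injective _ hinj
  have hsub : (((dyadicLevel S g i).image fun v => ({v} : Finset α)).sup id) ⊆ S := by
    refine Finset.sup_le fun T hT => ?_
    obtain ⟨v, hv, rfl⟩ := mem_image.1 hT
    exact singleton_subset_iff.2 (mem_filter.1 hv).1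
  refine ⟨_, hG i 1 (dyadicLevel S g i).card ⟨rfl, by exact_mod_cast hc0, by linarith, hi2⟩ _ ?_
    (hsub.trans hS), hsub⟩
  rw [← hcard]
  refine sup_mem_disjointUnions (image_subset_image (filter_subset_filter _ hS)) ?_
  intro A hA B hB hAB
  obtain ⟨v, -, rfl⟩ := mem_image.1 hA
  obtain ⟨w, -, rfl⟩ := mem_image.1 hB
  exact disjoint_singleton.2 fun hvw => hAB (by rw [hvw])

lemma sum_sum_filter_mem {α : Type*} [DecidableEq α] (V : Finset α) (Y : Finset (Finset α))
    (w : Finset α → ℝ) :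
    ∑ v ∈ V, ∑ T ∈ Y.filter (fun T => v ∈ T), w T =
      ∑ T ∈ Y, ((V.filter fun v => v ∈ T).card : ℝ) * w T := by
  simp only [sum_filter]
  rw [sum_comm]
  refine sum_congr rfl fun T _ => ?_
  rw [← sum_filter, sum_const, nsmul_eq_mul]

lemma cast_mul_quarter_pow_le {k : ℕ} (hk : 2 ≤ k) : (k : ℝ) * (1 / 4) ^ (k - 1) ≤ 1 / 2 := by
  obtain ⟨j, rfl⟩ := Nat.exists_eq_add_of_le' (by omega : 1 ≤ k)
  rw [add_tsub_cancel_right]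
  have h1 : ((j + 1 : ℕ) : ℝ) ≤ 2 ^ j := by exact_mod_cast (Nat.lt_two_pow_self : j < 2 ^ j)
  calc ((j + 1 : ℕ) : ℝ) * (1 / 4) ^ j ≤ 2 ^ j * (1 / 4) ^ j := by gcongr
    _ = (1 / 2) ^ j := by rw [← mul_pow]; norm_num
    _ ≤ (1 / 2) ^ 1 := pow_le_pow_of_le_one (by norm_num) (by norm_num) (by omega)
    _ = 1 / 2 := pow_one _

lemma exists_cover_of_linear_s16 {α : Type*} [DecidableEq α] (X : Finset α) {k : ℕ} (hk : 2 ≤ k)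
    {p q : ℝ} (hp : 0 < p) (hq : 0 ≤ q) (hqp : q ≤ p / 10 ^ 9) (g : Finset α → ℝ)
    (hg : ∀ T, 0 ≤ g T ∧ g T ≤ 1) (hsupp : ∀ T, g T ≠ 0 → T ⊆ X ∧ T.card = k)
    (hlin : ∀ e, g e ≠ 0 → ∀ e', g e' ≠ 0 → e ≠ e' → ∀ x ∈ e, x ∈ e' → ∀ y ∈ e, y ∈ e' → y = x)
    (hw : (∑ T ∈ X.powerset, g T) * p ^ k = 1) :
    ∃ G : Finset (Finset α), (∀ T ∈ G, T ⊆ X) ∧ wSet G q ≤ 1 ∧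
      ∀ S ⊆ X, 1 ≤ ∑ T ∈ S.powerset, g T → ∃ T ∈ G, T ⊆ S := by
  set a := p / 4 with ha
  have ha0 : 0 < a := by positivity
  set d : α → ℝ := fun v => ∑ T ∈ X.powerset.filter (fun T => v ∈ T), g T with hd
  have hd0 : ∀ v, 0 ≤ d v := fun v => sum_nonneg fun T _ => (hg T).1
  have hdX : ∑ v ∈ X, d v ≤ k * ∑ T ∈ X.powerset, g T := by
    rw [sum_sum_filter_mem, mul_sum]
    refine sum_le_sum fun T _ => ?_
    by_cases hT : g T = 0
    · simp [hT]
    · refine mul_le_mul_of_nonneg_right ?_ (hg T).1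
      rw [← (hsupp T hT).2]
      exact_mod_cast card_le_card fun v hv => (mem_filter.1 hv).2
  have hlev : ∀ i, ∀ e ∈ dyadicLevel X.powerset g i, g e ≠ 0 := fun i e he =>
    (lt_trans (by positivity) (mem_filter.1 he).2.1).ne'
  obtain ⟨G₁, hG₁X, hG₁w, hG₁⟩ := exists_cover_of_vertex_weights X
    (fun v => 32 * a ^ (k - 1) * d v) (fun v => mul_nonneg (by positivity) (hd0 v)) hp hq hqp (by
      have hpk : p ^ k = p ^ (k - 1) * p := by rw [← pow_succ, Nat.sub_add_cancel (by omega)]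
      have h1 := cast_mul_quarter_pow_le hk
      rw [← mul_sum]
      calc (32 * a ^ (k - 1) * ∑ v ∈ X, d v) * p
          ≤ 32 * a ^ (k - 1) * (k * ∑ T ∈ X.powerset, g T) * p := by gcongr
        _ = 32 * (k * (1 / 4) ^ (k - 1)) * ((∑ T ∈ X.powerset, g T) * p ^ k) := by
            rw [hpk, ha, div_eq_mul_one_div, mul_pow]; ring
        _ ≤ 16 := by rw [hw]; linarith)
  obtain ⟨G₂, hG₂X, hG₂w, hG₂⟩ := exists_cover_of_blocks X hq
    (fun i J => starBlocks (dyadicLevel X.powerset g i) X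
      (fun v => a ^ (k - 1) * ((dyadicLevel X.powerset g i).filter fun e => v ∈ e).card) J)
    (fun i J c => 1 ≤ J ∧ 1 ≤ c ∧
      a ^ k * (dyadicLevel X.powerset g i).card ≤ 4 * c * k * J ^ 2 * 2 ^ J ∧
      (3 / 2 : ℝ) ^ i / 8 ≤ 4 * c * k * J ^ 2 * 2 ^ J) (by
    rintro i J c ⟨hJ, hc, hm, hi⟩
    refine ⟨hJ, hc, star_union_weight_bound hk hJ hc ha0 hq (by rw [ha]; linarith)
      (sum_nonneg fun _ _ => by positivity) hm hi ?_⟩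
    exact wSet_starBlocks_mul_pow_le _ _ (fun e he => (hsupp e (hlev i e he)).2)
      (fun e he e' he' => hlin e (hlev i e he) e' (hlev i e' he')) hJ (by positivity) hq)
  refine ⟨G₁ ∪ G₂, fun T hT => (mem_union.1 hT).elim (hG₁X T) (hG₂X T), ?_, fun S hS hS1 => ?_⟩
  · have h1 : wSet (G₁ ∪ G₂) q + wSet (G₁ ∩ G₂) q = wSet G₁ q + wSet G₂ q := sum_union_inter
    have h2 : 0 ≤ wSet (G₁ ∩ G₂) q := sum_nonneg fun _ _ => by positivity
    linarith
  by_cases hbig : 1 ≤ ∑ v ∈ S, 32 * a ^ (k - 1) * d v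
  · obtain ⟨T, hT, hTS⟩ := hG₁ S hS hbig
    exact ⟨T, mem_union_left _ hT, hTS⟩
  push Not at hbig
  rw [← mul_sum] at hbig
  have hak : a ^ k * ∑ T ∈ X.powerset, g T ≤ 1 / 16 := by
    calc a ^ k * ∑ T ∈ X.powerset, g T
        = (1 / 4) ^ k * ((∑ T ∈ X.powerset, g T) * p ^ k) := by
          rw [ha, div_eq_mul_one_div, mul_pow]; ring
      _ ≤ (1 / 4) ^ 2 := by
          rw [hw, mul_one]
          exact pow_le_pow_of_le_one (by norm_num) (by norm_num) hk
      _ = 1 / 16 := by norm_num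
  obtain ⟨i, hi1, hi2⟩ := exists_large_dyadicLevel X.powerset S.powerset g
    (fun T => a ^ k + 2 * a ^ (k - 1) * (S.filter fun v => v ∈ T).card) hg
    (fun T => by positivity) (by
      have h1 := sum_sum_filter_mem S X.powerset g
      simp only [add_mul, sum_add_distrib]
      rw [← mul_sum]
      simp only [mul_assoc (2 * a ^ (k - 1))]
      rw [← mul_sum, ← h1]
      linarith) hS1
  set E := dyadicLevel X.powerset g i with hE
  set H := dyadicLevel S.powerset g i with hH
  have hHE : H ⊆ E := filter_subset_filter _ (powerset_mono.2 hS)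
  have hH0 : (0 : ℝ) < H.card := lt_of_lt_of_le (by positivity) hi2
  have hsumE : a ^ k * E.card +
      2 * ∑ v ∈ S, a ^ (k - 1) * ((E.filter fun e => v ∈ e).card : ℝ) ≤ H.card := by
    have h1 := sum_sum_filter_mem S E fun _ => 1
    simp only [sum_const, nsmul_eq_mul, mul_one] at h1
    rw [sum_add_distrib, sum_const, nsmul_eq_mul, ← mul_sum, ← h1] at hi1
    rw [← mul_sum]
    linarith
  have hsum0 : 0 ≤ ∑ v ∈ S, a ^ (k - 1) * ((E.filter fun e => v ∈ e).card : ℝ) :=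
    sum_nonneg fun v _ => by positivity
  have hak0 : 0 ≤ a ^ k * E.card := by positivity
  obtain ⟨J, hJ, F, hF, hFd, hFH⟩ := exists_disjoint_stars (k := k) (by omega)
    (fun v => a ^ (k - 1) * ((E.filter fun e => v ∈ e).card : ℝ)) (fun v => by positivity) S H
    (fun e he => ⟨mem_powerset.1 (mem_filter.1 he).1, (hsupp e (hlev i e (hHE he))).2⟩) hH0
    (by linarith)
  have hFS : F.sup id ⊆ S := by
    refine Finset.sup_le fun B hB => ?_
    obtain ⟨v, -, -, P, hP, -, rfl⟩ := mem_starBlocks.1 (hF hB)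
    exact Finset.sup_le fun e he =>
      mem_powerset.1 (mem_filter.1 (mem_filter.1 (hP he)).1).1
  have hc : 1 ≤ F.card := by
    by_contra! h
    have h0 : F.card = 0 := by omega
    simp only [h0, Nat.cast_zero, mul_zero, zero_mul] at hFH
    linarith
  exact ⟨_, mem_union_right _ (hG₂ i J F.card ⟨hJ, hc, by linarith, by linarith⟩ _
    (sup_mem_disjointUnions (hF.trans (starBlocks_mono hHE hS _ J)) hFd) (hFS.trans hS)), hFS⟩

/-- Theorem (linear case of the main theorem): if `|X| ≥ k`, `p ∈ [0,1]` and
`g : (X choose k) → [0,1]` has linear support (any two distinct vertices lie in at most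
one member of `supp(g)`), then `w(g,p) = 1` implies that there is `G ⊆ 2^X` with
`⟨g⟩ ⊆ ⟨G⟩` and `w(G, p/(10⁵·2¹²·e²)) ≤ 1`. -/
theorem stmt16 {α : Type*} [DecidableEq α] (X : Finset α) (k : ℕ) (hk : 0 < k)
    (hkX : k ≤ X.card) (p : ℝ) (hp0 : 0 ≤ p) (hp1 : p ≤ 1)
    (g : Finset α → ℝ) (hg : ∀ T, 0 ≤ g T ∧ g T ≤ 1)
    (hsupp : ∀ T, g T ≠ 0 → T ⊆ X ∧ T.card = k)
    (hlin : ∀ x y : α, x ≠ y →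
      ((X.powerset.filter fun T => g T ≠ 0 ∧ x ∈ T ∧ y ∈ T).card ≤ 1))
    (hw : wFun X g p = 1) :
    ∃ G : Finset (Finset α), (∀ T ∈ G, T ⊆ X) ∧
      (∀ S ∈ X.powerset, 1 ≤ ∑ T ∈ S.powerset, g T → ∃ T ∈ G, T ⊆ S) ∧
      wSet G (p / (10 ^ 5 * 2 ^ 12 * Real.exp 1 ^ 2)) ≤ 1 := by
  have hw' : (∑ T ∈ X.powerset, g T) * p ^ k = 1 := by
    rw [← hw, wFun, sum_mul]
    refine sum_congr rfl fun T _ => ?_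
    by_cases hT : g T = 0
    · simp [hT]
    · rw [(hsupp T hT).2]
  have hp : 0 < p := by
    refine lt_of_le_of_ne hp0 fun h => ?_
    rw [← h, zero_pow hk.ne', mul_zero] at hw'
    exact zero_ne_one hw'
  have hq : 0 ≤ p / (10 ^ 5 * 2 ^ 12 * Real.exp 1 ^ 2) := by positivity
  have hqp : p / (10 ^ 5 * 2 ^ 12 * Real.exp 1 ^ 2) ≤ p / 10 ^ 9 := by
    have h2 : (2 : ℝ) ^ 2 ≤ Real.exp 1 ^ 2 :=
      pow_le_pow_left₀ (by norm_num) (by linarith [Real.exp_one_gt_d9]) 2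
    refine div_le_div_of_nonneg_left hp0 (by norm_num) ?_
    linarith
  have hcover : ∃ G : Finset (Finset α), (∀ T ∈ G, T ⊆ X) ∧
      wSet G (p / (10 ^ 5 * 2 ^ 12 * Real.exp 1 ^ 2)) ≤ 1 ∧
      ∀ S ⊆ X, 1 ≤ ∑ T ∈ S.powerset, g T → ∃ T ∈ G, T ⊆ S := by
    rcases (by omega : k = 1 ∨ 2 ≤ k) with rfl | hk2
    · have hsingle : ∀ S : Finset α, ∑ v ∈ S, g {v} = ∑ T ∈ S.powerset, g T := by
        intro S
        rw [← sum_image (s := S) (g := fun v => ({v} : Finset α)) (f := g)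
          fun _ _ _ _ h => singleton_injective h]
        refine sum_subset (fun T hT => ?_) fun T hT hT' => ?_
        · obtain ⟨v, hv, rfl⟩ := mem_image.1 hT
          exact mem_powerset.2 (singleton_subset_iff.2 hv)
        · by_contra h0
          obtain ⟨v, rfl⟩ := card_eq_one.1 (hsupp T h0).2
          exact hT' (mem_image_of_mem _ (singleton_subset_iff.1 (mem_powerset.1 hT)))
      obtain ⟨G, hGX, hGw, hG⟩ := exists_cover_of_vertex_weights X (fun v => g {v})
        (fun v => (hg _).1) hp hq hqp (by
          rw [hsingle, ← pow_one p, hw']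
          norm_num)
      exact ⟨G, hGX, hGw.trans (by norm_num), fun S hS h1 => hG S hS (by rwa [hsingle])⟩
    · refine exists_cover_of_linear_s16 X hk2 hp hq hqp g hg hsupp ?_ hw'
      intro e he e' he' hne x hx hx' y hy hy'
      by_contra hyx
      exact hne (card_le_one.1 (hlin x y (Ne.symm hyx)) e
        (mem_filter.2 ⟨mem_powerset.2 (hsupp e he).1, he, hx, hy⟩) e'
        (mem_filter.2 ⟨mem_powerset.2 (hsupp e' he').1, he', hx', hy'⟩))
  obtain ⟨G, hGX, hGw, hG⟩ := hcover
  exact ⟨G, hGX, fun S hS => hG S (mem_powerset.1 hS), hGw⟩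
end
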